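/- (Canonical chain condition) Let T be NSOP₂ and suppose a ⫝^{K*}_M b. Then for any canonical Morley sequence I over M starting with b, there is I' ≡_{Mb} I that is indiscernible over Ma; and any such I' (i.e., any I' ≡_{Mb} I indiscernible over Ma) satisfies a ⫝^{K*}_M I'. -/

import Mathlib

/- Common model-theoretic infrastructure for formalizing
   "NSOP₂ theories are NSOP₁" (arXiv:2206.08512).

   We work with a monster model `𝕄` of a complete theory: a sufficiently
   saturated and strongly homogeneous `L`-structure.  Tuples are functions
   `α → 𝕄`; sets of formulas with parameters are coded via `FmlP`. -/

open FirstOrder Language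

universe u v w

namespace NSOP2Paper

/-- A first-order formula in free variables `α ⊕ Fin n` together with an
`n`-tuple of parameters from `𝕄`. -/
abbrev FmlP (L : FirstOrder.Language.{u, u}) (𝕄 : Type u) (α : Type v) :=
  Σ n : ℕ, L.Formula (α ⊕ Fin n) × (Fin n → 𝕄)

/-- `a ≡_C b` : the tuples `a` and `b` satisfy the same formulas with
parameters from `C`. -/
def EqTpOver (L : FirstOrder.Language.{u, u}) {𝕄 : Type u} [L.Structure 𝕄] (C : Set 𝕄)
    {α : Type v} (a b : α → 𝕄) : Prop :=
  ∀ (n : ℕ) (φ : L.Formula (α ⊕ Fin n)) (c : Fin n → 𝕄), (∀ i, c i ∈ C) →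
    (φ.Realize (Sum.elim a c) ↔ φ.Realize (Sum.elim b c))

/-- `tp(a / C)` is finitely satisfiable in `Ms`: every formula over `C`
satisfied by `a` has a realization by a tuple from `Ms`. -/
def FinSatIn (L : FirstOrder.Language.{u, u}) {𝕄 : Type u} [L.Structure 𝕄] (Ms : Set 𝕄)
    {α : Type v} (a : α → 𝕄) (C : Set 𝕄) : Prop :=
  ∀ (n : ℕ) (φ : L.Formula (α ⊕ Fin n)) (c : Fin n → 𝕄), (∀ i, c i ∈ C) →
    φ.Realize (Sum.elim a c) →
    ∃ m : α → 𝕄, (∀ i, m i ∈ Ms) ∧ φ.Realize (Sum.elim m c)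

/-- `Ms` is the underlying set of a (small) elementary submodel of `𝕄`. -/
def IsElemSubmodel (L : FirstOrder.Language.{u, u}) {𝕄 : Type u} [L.Structure 𝕄] (Ms : Set 𝕄) : Prop :=
  ∃ S : L.ElementarySubstructure 𝕄, (S : Set 𝕄) = Ms

/-- A complete consistent global type (a complete type over the monster `𝕄`)
in variables `α`, coded as the set of formulas-with-parameters it contains. -/
structure GlobalType (L : FirstOrder.Language.{u, u}) (𝕄 : Type u) [L.Structure 𝕄] (α : Type v) where
  carrier : Set (FmlP L 𝕄 α)
  consistent : ∀ t : Finset (FmlP L 𝕄 α), ↑t ⊆ carrier →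
    ∃ a : α → 𝕄, ∀ p ∈ t, p.2.1.Realize (Sum.elim a p.2.2)
  complete : ∀ (n : ℕ) (φ : L.Formula (α ⊕ Fin n)) (c : Fin n → 𝕄),
    (⟨n, (φ, c)⟩ : FmlP L 𝕄 α) ∈ carrier ∨ (⟨n, (φ.not, c)⟩ : FmlP L 𝕄 α) ∈ carrier

variable {L : FirstOrder.Language.{u, u}} {𝕄 : Type u} [L.Structure 𝕄]

/-- The global type `q` is finitely satisfiable in `Ms` (i.e. it is a coheir of
its restriction to `Ms`). -/
def GlobalType.FinSatInM {α : Type v} (q : GlobalType L 𝕄 α) (Ms : Set 𝕄) : Prop :=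
  ∀ t : Finset (FmlP L 𝕄 α), ↑t ⊆ q.carrier →
    ∃ m : α → 𝕄, (∀ i, m i ∈ Ms) ∧ ∀ p ∈ t, p.2.1.Realize (Sum.elim m p.2.2)

/-- `a ⊨ q|_C` : the tuple `a` realizes the restriction of the global type `q`
to parameters from `C`. -/
def RealizesType {α : Type v} (q : GlobalType L 𝕄 α) (a : α → 𝕄) (C : Set 𝕄) : Prop :=
  ∀ (n : ℕ) (φ : L.Formula (α ⊕ Fin n)) (c : Fin n → 𝕄), (∀ i, c i ∈ C) →
    (⟨n, (φ, c)⟩ : FmlP L 𝕄 α) ∈ q.carrier → φ.Realize (Sum.elim a c)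

/-- The global type `q` extends `tp(a / C)`. -/
def ExtendsTpOver {α : Type v} (q : GlobalType L 𝕄 α) (C : Set 𝕄) (a : α → 𝕄) : Prop :=
  ∀ (n : ℕ) (φ : L.Formula (α ⊕ Fin n)) (c : Fin n → 𝕄), (∀ i, c i ∈ C) →
    φ.Realize (Sum.elim a c) → (⟨n, (φ, c)⟩ : FmlP L 𝕄 α) ∈ q.carrier

/-- `B` is a coheir Morley sequence over `Ms` in the global type `q`:
`q` is finitely satisfiable in `Ms` and `B i ⊨ q|_(Ms ∪ B_{<i})`. -/
def MorleyIn {α : Type v} (q : GlobalType L 𝕄 α) (Ms : Set 𝕄) (B : ℕ → α → 𝕄) : Prop :=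
  q.FinSatInM Ms ∧
    ∀ i : ℕ, RealizesType q (B i) (Ms ∪ ⋃ (j : ℕ) (_ : j < i), Set.range (B j))

/-- `B` is a coheir Morley sequence over `Ms`. -/
def CoheirMorley (L : FirstOrder.Language.{u, u}) {𝕄 : Type u} [L.Structure 𝕄] (Ms : Set 𝕄)
    {α : Type v} (B : ℕ → α → 𝕄) : Prop :=
  ∃ q : GlobalType L 𝕄 α, MorleyIn q Ms B

/-- Flatten an `ℕ`-indexed sequence of `α`-tuples into a single tuple. -/
def flatSeq {α : Type v} (I : ℕ → α → 𝕄) : ℕ × α → 𝕄 := fun p => I p.1 p.2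

/-- The sequence `I` is indiscernible over `C`. -/
def IndiscernibleOver (L : FirstOrder.Language.{u, u}) {𝕄 : Type u} [L.Structure 𝕄] (C : Set 𝕄)
    {α : Type v} (I : ℕ → α → 𝕄) : Prop :=
  ∀ (n : ℕ) (f g : Fin n → ℕ), StrictMono f → StrictMono g →
    EqTpOver L C (fun p : Fin n × α => I (f p.1) p.2) (fun p : Fin n × α => I (g p.1) p.2)

/-- `𝕄` is `κ`-saturated: every finitely satisfiable set of formulas in fewer
than `κ` variables over a parameter set of size `< κ` is realized in `𝕄`. -/
def IsSaturated (L : FirstOrder.Language.{u, u}) (𝕄 : Type u) [L.Structure 𝕄] (κ : Cardinal.{u}) : Prop :=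
  ∀ (α : Type u) (A : Set 𝕄), Cardinal.mk α < κ → Cardinal.mk A < κ →
    ∀ Γ : Set (FmlP L 𝕄 α), (∀ p ∈ Γ, ∀ i, p.2.2 i ∈ A) →
      (∀ t : Finset (FmlP L 𝕄 α), ↑t ⊆ Γ →
        ∃ a : α → 𝕄, ∀ p ∈ t, p.2.1.Realize (Sum.elim a p.2.2)) →
      ∃ a : α → 𝕄, ∀ p ∈ Γ, p.2.1.Realize (Sum.elim a p.2.2)

/-- `𝕄` is strongly `κ`-homogeneous: partial elementary maps between tuples of
length `< κ` extend to automorphisms of `𝕄`. -/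
def IsStronglyHomogeneous (L : FirstOrder.Language.{u, u}) (𝕄 : Type u) [L.Structure 𝕄]
    (κ : Cardinal.{u}) : Prop :=
  ∀ (α : Type u), Cardinal.mk α < κ → ∀ a b : α → 𝕄, EqTpOver L (∅ : Set 𝕄) a b →
    ∃ σ : 𝕄 ≃[L] 𝕄, ∀ i, σ (a i) = b i

/-- `𝕄` is a monster model (for smallness degree `κ`): sufficiently saturated
and strongly homogeneous. -/
def IsMonster (L : FirstOrder.Language.{u, u}) (𝕄 : Type u) [L.Structure 𝕄] (κ : Cardinal.{u}) : Prop :=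
  Cardinal.aleph0 < κ ∧ IsSaturated L 𝕄 κ ∧ IsStronglyHomogeneous L 𝕄 κ

/-! ### Tree combinatorics -/

/-- The meet (longest common prefix) of two finite sequences. -/
def meet {A : Type w} [DecidableEq A] : List A → List A → List A
  | a :: as, b :: bs => if a = b then a :: meet as bs else []
  | _, _ => []

/-- The meet of `η 0, …, η i`. -/
def combMeet {A : Type w} [DecidableEq A] {k : ℕ} (η : Fin k → List A) (i : Fin k) : List A :=
  (List.ofFn fun j : Fin i.val => η (Fin.castLE i.2.le j)).foldl meet (η i)

/-- `η 0, …, η (k-1)` is a descending comb: a lexicographically increasing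
antichain such that the meet of `η 0, …, η (i+1)` is a proper initial segment
of the meet of `η 0, …, η i`. -/
def DescendingComb {A : Type w} [DecidableEq A] [LT A] {k : ℕ} (η : Fin k → List A) : Prop :=
  (∀ i j : Fin k, i ≠ j → ¬ η i <+: η j) ∧
  (∀ i j : Fin k, i < j → List.Lex (· < ·) (η i) (η j)) ∧
  (∀ (i : ℕ) (h : i + 1 < k),
    combMeet η ⟨i + 1, h⟩ <+: combMeet η ⟨i, by omega⟩ ∧
    combMeet η ⟨i + 1, h⟩ ≠ combMeet η ⟨i, by omega⟩)

/-! ### Tree properties of theories (witnessed in the monster model) -/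

/-- `T = Th(𝕄)` has `SOP₁`. -/
def HasSOP1 (L : FirstOrder.Language.{u, u}) (𝕄 : Type u) [L.Structure 𝕄] : Prop :=
  ∃ (k m : ℕ) (φ : L.Formula (Fin k ⊕ Fin m)) (b : List Bool → Fin m → 𝕄),
    (∀ σ : ℕ → Bool, ∃ a : Fin k → 𝕄,
      ∀ n : ℕ, φ.Realize (Sum.elim a (b (List.ofFn fun i : Fin n => σ i)))) ∧
    ∀ η₁ η₂ : List Bool, (η₁ ++ [false]) <+: η₂ →
      ¬ ∃ a : Fin k → 𝕄, φ.Realize (Sum.elim a (b η₂)) ∧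
        φ.Realize (Sum.elim a (b (η₁ ++ [true])))

/-- `T = Th(𝕄)` has `SOP₂`. -/
def HasSOP2 (L : FirstOrder.Language.{u, u}) (𝕄 : Type u) [L.Structure 𝕄] : Prop :=
  ∃ (k m : ℕ) (φ : L.Formula (Fin k ⊕ Fin m)) (b : List Bool → Fin m → 𝕄),
    (∀ σ : ℕ → Bool, ∃ a : Fin k → 𝕄,
      ∀ n : ℕ, φ.Realize (Sum.elim a (b (List.ofFn fun i : Fin n => σ i)))) ∧
    ∀ η₁ η₂ : List Bool, ¬ η₁ <+: η₂ → ¬ η₂ <+: η₁ →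
      ¬ ∃ a : Fin k → 𝕄, φ.Realize (Sum.elim a (b η₁)) ∧ φ.Realize (Sum.elim a (b η₂))

/-- `T = Th(𝕄)` has `k`-`DCTP₁`: paths are consistent but descending combs of
size `k` are inconsistent. -/
def HasKDCTP1 (L : FirstOrder.Language.{u, u}) (𝕄 : Type u) [L.Structure 𝕄] (k : ℕ) : Prop :=
  ∃ (r m : ℕ) (φ : L.Formula (Fin r ⊕ Fin m)) (b : List ℕ → Fin m → 𝕄),
    (∀ σ : ℕ → ℕ, ∃ a : Fin r → 𝕄,
      ∀ n : ℕ, φ.Realize (Sum.elim a (b (List.ofFn fun i : Fin n => σ i)))) ∧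
    ∀ η : Fin k → List ℕ, DescendingComb η →
      ¬ ∃ a : Fin r → 𝕄, ∀ i, φ.Realize (Sum.elim a (b (η i)))

/-- `T = Th(𝕄)` has weak `k`-`TP₁`: paths are consistent but any `k` pairwise
incomparable nodes with common pairwise meet are inconsistent. -/
def HasWeakKTP1 (L : FirstOrder.Language.{u, u}) (𝕄 : Type u) [L.Structure 𝕄] (k : ℕ) : Prop :=
  ∃ (r m : ℕ) (φ : L.Formula (Fin r ⊕ Fin m)) (b : List ℕ → Fin m → 𝕄),
    (∀ σ : ℕ → ℕ, ∃ a : Fin r → 𝕄,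
      ∀ n : ℕ, φ.Realize (Sum.elim a (b (List.ofFn fun i : Fin n => σ i)))) ∧
    ∀ η : Fin k → List ℕ,
      (∀ i j, i ≠ j → ¬ η i <+: η j) →
      (∀ i j i' j' : Fin k, i ≠ j → i' ≠ j' → meet (η i) (η j) = meet (η i') (η j')) →
      ¬ ∃ a : Fin r → 𝕄, ∀ i, φ.Realize (Sum.elim a (b (η i)))

/-- `T = Th(𝕄)` has `k`-`DCTP₂`: paths are `k`-inconsistent but descending
combs are consistent. -/
def HasKDCTP2 (L : FirstOrder.Language.{u, u}) (𝕄 : Type u) [L.Structure 𝕄] (k : ℕ) : Prop :=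
  ∃ (r m : ℕ) (φ : L.Formula (Fin r ⊕ Fin m)) (b : List Bool → Fin m → 𝕄),
    (∀ σ : ℕ → Bool, ∀ s : Finset ℕ, s.card = k →
      ¬ ∃ a : Fin r → 𝕄, ∀ n ∈ s,
        φ.Realize (Sum.elim a (b (List.ofFn fun i : Fin n => σ i)))) ∧
    ∀ (l : ℕ) (η : Fin l → List Bool), DescendingComb η →
      ∃ a : Fin r → 𝕄, ∀ i, φ.Realize (Sum.elim a (b (η i)))

/-! ### Kim-dividing and Conant-dividing, with respect to coheir Morley sequences -/

/-- `φ(x, b)` Kim-divides over `Ms`: some coheir Morley sequence over `Ms`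
starting with `b` makes it inconsistent. -/
def KimDivides (L : FirstOrder.Language.{u, u}) {𝕄 : Type u} [L.Structure 𝕄] (Ms : Set 𝕄)
    {α : Type v} {n : ℕ} (φ : L.Formula (α ⊕ Fin n)) (b : Fin n → 𝕄) : Prop :=
  ∃ B : ℕ → Fin n → 𝕄, CoheirMorley L Ms B ∧ B 0 = b ∧
    ¬ ∃ a : α → 𝕄, ∀ i, φ.Realize (Sum.elim a (B i))

/-- `φ(x, b)` Kim-forks over `Ms`: it implies a finite disjunction of formulas
Kim-dividing over `Ms`. -/
def KimForks (L : FirstOrder.Language.{u, u}) {𝕄 : Type u} [L.Structure 𝕄] (Ms : Set 𝕄)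
    {α : Type v} {n : ℕ} (φ : L.Formula (α ⊕ Fin n)) (b : Fin n → 𝕄) : Prop :=
  ∃ (N : ℕ) (m : Fin N → ℕ) (ψ : ∀ j : Fin N, L.Formula (α ⊕ Fin (m j)))
    (c : ∀ j : Fin N, Fin (m j) → 𝕄),
    (∀ j, KimDivides L Ms (ψ j) (c j)) ∧
    ∀ a : α → 𝕄, φ.Realize (Sum.elim a b) → ∃ j, (ψ j).Realize (Sum.elim a (c j))

/-- `φ(x, b)` Conant-divides over `Ms`: every coheir Morley sequence over `Ms`
starting with `b` makes it inconsistent. -/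
def ConantDivides (L : FirstOrder.Language.{u, u}) {𝕄 : Type u} [L.Structure 𝕄] (Ms : Set 𝕄)
    {α : Type v} {n : ℕ} (φ : L.Formula (α ⊕ Fin n)) (b : Fin n → 𝕄) : Prop :=
  ∀ B : ℕ → Fin n → 𝕄, CoheirMorley L Ms B → B 0 = b →
    ¬ ∃ a : α → 𝕄, ∀ i, φ.Realize (Sum.elim a (B i))

/-- `φ(x, b)` Conant-forks over `Ms`. -/
def ConantForks (L : FirstOrder.Language.{u, u}) {𝕄 : Type u} [L.Structure 𝕄] (Ms : Set 𝕄)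
    {α : Type v} {n : ℕ} (φ : L.Formula (α ⊕ Fin n)) (b : Fin n → 𝕄) : Prop :=
  ∃ (N : ℕ) (m : Fin N → ℕ) (ψ : ∀ j : Fin N, L.Formula (α ⊕ Fin (m j)))
    (c : ∀ j : Fin N, Fin (m j) → 𝕄),
    (∀ j, ConantDivides L Ms (ψ j) (c j)) ∧
    ∀ a : α → 𝕄, φ.Realize (Sum.elim a b) → ∃ j, (ψ j).Realize (Sum.elim a (c j))

/-- `a ⫝^{K*}_{Ms} b` : `tp(a/Ms b)` contains no formula Conant-forking
over `Ms`. -/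
def ConantIndep (L : FirstOrder.Language.{u, u}) {𝕄 : Type u} [L.Structure 𝕄] (Ms : Set 𝕄)
    {α : Type v} {β : Type w} (a : α → 𝕄) (b : β → 𝕄) : Prop :=
  ∀ (n : ℕ) (φ : L.Formula (α ⊕ Fin n)) (d : Fin n → 𝕄),
    (∀ i, d i ∈ Ms ∪ Set.range b) → φ.Realize (Sum.elim a d) →
    ¬ ConantForks L Ms φ d

/-! ### Abstract independence relations between sets over models -/

/-- An abstract ternary relation `A ⫝_M B` between subsets of `𝕄` over
(elementary submodels of) `𝕄`. -/
structure IndRel (L : FirstOrder.Language.{u, u}) (𝕄 : Type u) [L.Structure 𝕄] where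
  rel : Set 𝕄 → Set 𝕄 → Set 𝕄 → Prop

/-- A set `S` of `α`-tuples is type-definable over `C`. -/
def TypeDefinableOver (L : FirstOrder.Language.{u, u}) {𝕄 : Type u} [L.Structure 𝕄] (C : Set 𝕄)
    {γ : Type v} (S : Set (γ → 𝕄)) : Prop :=
  ∃ Γ : Set (FmlP L 𝕄 γ), (∀ p ∈ Γ, ∀ i, p.2.2 i ∈ C) ∧
    ∀ g : γ → 𝕄, g ∈ S ↔ ∀ p ∈ Γ, p.2.1.Realize (Sum.elim g p.2.2)

namespace IndRel


/-- Invariance under automorphisms of `𝕄`. -/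
def Invariant (R : IndRel L 𝕄) : Prop :=
  ∀ (σ : 𝕄 ≃[L] 𝕄) (A Ms B : Set 𝕄), R.rel A Ms B →
    R.rel ((⇑σ) '' A) ((⇑σ) '' Ms) ((⇑σ) '' B)

/-- Monotonicity (on both sides). -/
def Mono (R : IndRel L 𝕄) : Prop :=
  ∀ (A A' Ms B B' : Set 𝕄), IsElemSubmodel L Ms → R.rel A Ms B →
    Ms ⊆ A' → A' ⊆ A → Ms ⊆ B' → B' ⊆ B → R.rel A' Ms B'

/-- Existence: for `M ⊆ A, B` there is `A' ≡_M A` with `A' ⫝_M B`. -/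
def Existence (R : IndRel L 𝕄) (κ : Cardinal.{u}) : Prop :=
  ∀ (Ms : Set 𝕄), IsElemSubmodel L Ms → Cardinal.mk Ms < κ →
    ∀ (α β : Type u), Cardinal.mk α < κ → Cardinal.mk β < κ →
      ∀ (a : α → 𝕄) (b : β → 𝕄),
        ∃ a' : α → 𝕄, EqTpOver L Ms a' a ∧
          R.rel (Ms ∪ Set.range a') Ms (Ms ∪ Set.range b)

/-- Right extension. -/
def RightExt (R : IndRel L 𝕄) (κ : Cardinal.{u}) : Prop :=
  ∀ (Ms : Set 𝕄), IsElemSubmodel L Ms → Cardinal.mk Ms < κ →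
    ∀ (α : Type u), Cardinal.mk α < κ → ∀ (a : α → 𝕄) (B C : Set 𝕄),
      Cardinal.mk B < κ → Cardinal.mk C < κ →
      R.rel (Set.range a) Ms B → B ⊆ C →
      ∃ a' : α → 𝕄, EqTpOver L B a' a ∧ R.rel (Set.range a') Ms C

/-- Quasi-strong finite character: for complete types `p = tp(a₀/Ms)` and
`q = tp(b₀/Ms)`, the set of pairs of realizations `(a, b)` with `a ⫝_Ms b`
is type-definable over `Ms`. -/
def QSFC (R : IndRel L 𝕄) (κ : Cardinal.{u}) : Prop :=
  ∀ (Ms : Set 𝕄), IsElemSubmodel L Ms → Cardinal.mk Ms < κ →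
    ∀ (α β : Type u), Cardinal.mk α < κ → Cardinal.mk β < κ →
      ∀ (a₀ : α → 𝕄) (b₀ : β → 𝕄),
        TypeDefinableOver L Ms {g : (α ⊕ β) → 𝕄 |
          EqTpOver L Ms (g ∘ Sum.inl) a₀ ∧ EqTpOver L Ms (g ∘ Sum.inr) b₀ ∧
          R.rel (Set.range (g ∘ Sum.inl)) Ms (Set.range (g ∘ Sum.inr))}

/-- The coheir chain condition. -/
def CoheirChain (R : IndRel L 𝕄) (κ : Cardinal.{u}) : Prop :=
  ∀ (Ms : Set 𝕄), IsElemSubmodel L Ms → Cardinal.mk Ms < κ →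
    ∀ (α β : Type u), Cardinal.mk α < κ → Cardinal.mk β < κ →
      ∀ (a : α → 𝕄) (b : β → 𝕄), R.rel (Set.range a) Ms (Set.range b) →
        ∀ I : ℕ → β → 𝕄, CoheirMorley L Ms I → I 0 = b →
          ∃ I' : ℕ → β → 𝕄, EqTpOver L Ms (flatSeq I') (flatSeq I) ∧
            R.rel (Set.range a) Ms (⋃ i, Set.range (I' i)) ∧
            ∀ i, EqTpOver L (Ms ∪ Set.range a) (I' i) b

/-- `R` implies `⫝ʰ` : `A ⫝_M B` implies `tp(B / M A)` is finitely
satisfiable in `M`. -/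
def StrongerThanH (R : IndRel L 𝕄) : Prop :=
  ∀ (A Ms B : Set 𝕄), IsElemSubmodel L Ms → R.rel A Ms B →
    FinSatIn L Ms (fun x : B => (x : 𝕄)) (Ms ∪ A)

end IndRel

/-- The axioms satisfied by the relations among which `⫝^CK` is weakest. -/
def GoodRel (R : IndRel L 𝕄) (κ : Cardinal.{u}) : Prop :=
  R.StrongerThanH ∧ R.Invariant ∧ R.Mono ∧ R.Existence κ ∧ R.RightExt κ ∧ R.CoheirChain κ

/-- `R` is `⫝^CK` : the weakest relation implying `⫝ʰ` and satisfying
invariance, monotonicity, existence, right extension and the coheir chain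
condition. -/
def IsCK (R : IndRel L 𝕄) (κ : Cardinal.{u}) : Prop :=
  GoodRel R κ ∧ ∀ R' : IndRel L 𝕄, GoodRel R' κ →
    ∀ A Ms B : Set 𝕄, R'.rel A Ms B → R.rel A Ms B

/-- `q` is a canonical global type over `Ms` (w.r.t. the relation `R = ⫝^CK`):
whenever `c ⊨ q|_{Ms b}` we have `b ⫝^CK_{Ms} c`. -/
def IsCanonicalGlobal (R : IndRel L 𝕄) (κ : Cardinal.{u}) (Ms : Set 𝕄) {α : Type v}
    (q : GlobalType L 𝕄 α) : Prop :=
  ∀ (β : Type u), Cardinal.mk β < κ → ∀ (b : β → 𝕄) (c : α → 𝕄),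
    RealizesType q c (Ms ∪ Set.range b) → R.rel (Set.range b) Ms (Set.range c)

/-- A canonical Morley sequence over `Ms`: a coheir Morley sequence in a
canonical coheir. -/
def CanonicalMorley (R : IndRel L 𝕄) (κ : Cardinal.{u}) (Ms : Set 𝕄) {α : Type v}
    (I : ℕ → α → 𝕄) : Prop :=
  ∃ q : GlobalType L 𝕄 α, IsCanonicalGlobal R κ Ms q ∧ MorleyIn q Ms I

/-- `q` is a strong canonical global type over `Ms`. -/
def IsStrongCanonical (R : IndRel L 𝕄) (κ : Cardinal.{u}) (Ms : Set 𝕄) {α : Type v}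
    (q : GlobalType L 𝕄 α) : Prop :=
  ∀ (β : Type u), Cardinal.mk β < κ → ∀ (b : β → 𝕄) (c : α → 𝕄),
    RealizesType q c (Ms ∪ Set.range b) →
    ∀ (γ : Type u), Cardinal.mk γ < κ → ∀ (a : γ → 𝕄),
      ∃ a' : γ → 𝕄, EqTpOver L (Ms ∪ Set.range c) a' a ∧
        ∃ q' : GlobalType L 𝕄 (γ ⊕ α), IsCanonicalGlobal R κ Ms q' ∧
          ExtendsTpOver q' (Ms ∪ Set.range b) (Sum.elim a' c)

/-! ### `M`-invariant ideals and `𝓘`-Kim-dividing -/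

/-- An `Ms`-invariant ideal on the definable subsets of `𝕄` (in variables `α`). -/
structure InvIdeal (L : FirstOrder.Language.{u, u}) (𝕄 : Type u) [L.Structure 𝕄] (Ms : Set 𝕄)
    (α : Type v) where
  mem : Set (α → 𝕄) → Prop
  definable_of_mem : ∀ S, mem S → ∃ (n : ℕ) (ψ : L.Formula (α ⊕ Fin n)) (c : Fin n → 𝕄),
    S = {a : α → 𝕄 | ψ.Realize (Sum.elim a c)}
  union_mem : ∀ S T, mem S → mem T → mem (S ∪ T)
  subset_mem : ∀ S T, mem S →
    (∃ (n : ℕ) (ψ : L.Formula (α ⊕ Fin n)) (c : Fin n → 𝕄),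
      T = {a : α → 𝕄 | ψ.Realize (Sum.elim a c)}) →
    T ⊆ S → mem T
  invariant : ∀ σ : 𝕄 ≃[L] 𝕄, (∀ x ∈ Ms, σ x = x) → ∀ S, mem S →
    mem ((fun a => (⇑σ) ∘ a) '' S)

/-- `φ(x, b)` `𝓘`-Kim-divides over `Ms`. -/
def IKimDivides {Ms : Set 𝕄} {α : Type v} (I : InvIdeal L 𝕄 Ms α) {n : ℕ}
    (φ : L.Formula (α ⊕ Fin n)) (b : Fin n → 𝕄) : Prop :=
  ∃ (B : ℕ → Fin n → 𝕄) (k : ℕ), CoheirMorley L Ms B ∧ B 0 = b ∧ 0 < k ∧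
    ∀ s : Finset ℕ, s.card = k →
      I.mem {a : α → 𝕄 | ∀ i ∈ s, φ.Realize (Sum.elim a (B i))}

/-- `φ(x, b)` `𝓘`-Kim-forks over `Ms`. -/
def IKimForks {Ms : Set 𝕄} {α : Type v} (I : InvIdeal L 𝕄 Ms α) {n : ℕ}
    (φ : L.Formula (α ⊕ Fin n)) (b : Fin n → 𝕄) : Prop :=
  ∃ (N : ℕ) (m : Fin N → ℕ) (ψ : ∀ j : Fin N, L.Formula (α ⊕ Fin (m j)))
    (c : ∀ j : Fin N, Fin (m j) → 𝕄),
    (∀ j, IKimDivides I (ψ j) (c j)) ∧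
    ∀ a : α → 𝕄, φ.Realize (Sum.elim a b) → ∃ j, (ψ j).Realize (Sum.elim a (c j))

/-- `φ(x, b)` `𝓘`-quasi-divides over `Ms`. -/
def IQuasiDivides {Ms : Set 𝕄} {α : Type v} (I : InvIdeal L 𝕄 Ms α) {n : ℕ}
    (φ : L.Formula (α ⊕ Fin n)) (b : Fin n → 𝕄) : Prop :=
  ∃ (mm : ℕ) (b' : Fin mm → Fin n → 𝕄), 0 < mm ∧ (∀ j, EqTpOver L Ms (b' j) b) ∧
    I.mem {a : α → 𝕄 | ∀ j, φ.Realize (Sum.elim a (b' j))}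

/-! ### `h^⫝`-inconsistency and the derived relation `⫝'` -/

/-- A family of formulas is `h^⫝`-inconsistent with respect to `P = tp(a₀/Ms)`. -/
def HInconsistent (R : IndRel L 𝕄) (Ms : Set 𝕄) {α : Type v} (a₀ : α → 𝕄)
    {ι : Type w} (m : ι → ℕ) (φ : ∀ i : ι, L.Formula (α ⊕ Fin (m i)))
    (b : ∀ i : ι, Fin (m i) → 𝕄) : Prop :=
  ¬ ∃ a : α → 𝕄, EqTpOver L Ms a a₀ ∧
      R.rel (Set.range a) Ms (⋃ i, Set.range (b i)) ∧
      ∀ i, (φ i).Realize (Sum.elim a (b i))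

/-- A single formula is `h^⫝`-inconsistent with respect to `P = tp(a₀/Ms)`. -/
def HInconsistentSingle (R : IndRel L 𝕄) (Ms : Set 𝕄) {α : Type v} (a₀ : α → 𝕄)
    {n : ℕ} (φ : L.Formula (α ⊕ Fin n)) (b : Fin n → 𝕄) : Prop :=
  ¬ ∃ a : α → 𝕄, EqTpOver L Ms a a₀ ∧ R.rel (Set.range a) Ms (Set.range b) ∧
      φ.Realize (Sum.elim a b)

/-- `φ(x, b)` `h^⫝`-Kim-divides with respect to `tp(a₀/Ms)`. -/
def HKimDivides (R : IndRel L 𝕄) (Ms : Set 𝕄) {α : Type v} (a₀ : α → 𝕄)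
    {n : ℕ} (φ : L.Formula (α ⊕ Fin n)) (b : Fin n → 𝕄) : Prop :=
  ∃ B : ℕ → Fin n → 𝕄, CoheirMorley L Ms B ∧ B 0 = b ∧
    HInconsistent R Ms a₀ (fun _ : ℕ => n) (fun _ => φ) B

/-- `φ(x, b)` `h^⫝`-Kim-forks with respect to `tp(a₀/Ms)`. -/
def HKimForks (R : IndRel L 𝕄) (Ms : Set 𝕄) {α : Type v} (a₀ : α → 𝕄)
    {n : ℕ} (φ : L.Formula (α ⊕ Fin n)) (b : Fin n → 𝕄) : Prop :=
  ∃ (N : ℕ) (m : Fin N → ℕ) (ψ : ∀ j : Fin N, L.Formula (α ⊕ Fin (m j)))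
    (c : ∀ j : Fin N, Fin (m j) → 𝕄),
    (∀ j, HKimDivides R Ms a₀ (ψ j) (c j)) ∧
    ∀ a : α → 𝕄, φ.Realize (Sum.elim a b) → ∃ j, (ψ j).Realize (Sum.elim a (c j))

/-- `φ(x, b)` `h^⫝`-quasi-divides with respect to `tp(a₀/Ms)`. -/
def HQuasiDivides (R : IndRel L 𝕄) (Ms : Set 𝕄) {α : Type v} (a₀ : α → 𝕄)
    {n : ℕ} (φ : L.Formula (α ⊕ Fin n)) (b : Fin n → 𝕄) : Prop :=
  ∃ (mm : ℕ) (b' : Fin mm → Fin n → 𝕄), 0 < mm ∧ (∀ j, EqTpOver L Ms (b' j) b) ∧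
    HInconsistent R Ms a₀ (fun _ : Fin mm => n) (fun _ => φ) b'

/-- The derived relation `⫝'` on tuples:
`tp(a / Ms b)` contains no formula `h^⫝`-Kim-forking w.r.t. `tp(a/Ms)`. -/
def DerivedIndep (R : IndRel L 𝕄) (Ms : Set 𝕄) {α : Type v} {β : Type w}
    (a : α → 𝕄) (b : β → 𝕄) : Prop :=
  ∀ (n : ℕ) (φ : L.Formula (α ⊕ Fin n)) (d : Fin n → 𝕄),
    (∀ i, d i ∈ Ms ∪ Set.range b) → φ.Realize (Sum.elim a d) →
    ¬ HKimForks R Ms a φ d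

/-- The derived relation `⫝'` as a relation between sets over models. -/
def derived (R : IndRel L 𝕄) : IndRel L 𝕄 where
  rel A Ms B := ∀ (n : ℕ) (φ : L.Formula (↥A ⊕ Fin n)) (d : Fin n → 𝕄),
    (∀ i, d i ∈ Ms ∪ B) → φ.Realize (Sum.elim (fun x : A => (x : 𝕄)) d) →
    ¬ HKimForks R Ms (fun x : A => (x : 𝕄)) φ d

/-! ### Coheir trees -/

/-- The tuple, indexed by extensions, consisting of the part of the tree `c`
lying (weakly) above the node `ν` (where `ν` has length `Lh`). -/
def subtreeTupleLen {α : Type v} {n : ℕ} (c : {l : List ℕ // l.length ≤ n} → α → 𝕄)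
    (Lh : ℕ) (ν : List ℕ) (hν : ν.length = Lh) :
    ({s : List ℕ // Lh + s.length ≤ n} × α) → 𝕄 :=
  fun p => c ⟨ν ++ p.1.1, by rw [List.length_append, hν]; exact p.1.2⟩ p.2

end NSOP2Paper

namespace NSOP2Paper

section FormulaLemmas

variable {L : FirstOrder.Language.{u, u}} {𝕄 : Type u} [L.Structure 𝕄]

/-- A formula only mentions finitely many of the parameter variables. -/
theorem exists_fin_params {A C : Type*} (χ : L.Formula (A ⊕ C)) :
    ∃ (n : ℕ) (χ' : L.Formula (A ⊕ Fin n)) (f : Fin n → C), Function.Injective f ∧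
      ∀ (N : Type u) [L.Structure N] (v : A → N) (c : C → N),
        χ.Realize (Sum.elim v c) ↔ χ'.Realize (Sum.elim v (c ∘ f)) := by
  classical
  let s : Finset C := χ.freeVarFinset.preimage Sum.inr Sum.inr_injective.injOn
  let e := s.equivFin
  let g : χ.freeVarFinset → A ⊕ Fin s.card := fun x =>
    match x with
    | ⟨Sum.inl a, _⟩ => Sum.inl a
    | ⟨Sum.inr c, h⟩ => Sum.inr (e ⟨c, by simpa [s] using h⟩)
  refine ⟨s.card, BoundedFormula.restrictFreeVar χ g, fun i => (e.symm i).1,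
    Subtype.val_injective.comp e.symm.injective, fun N _ v c => ?_⟩
  rw [Formula.Realize, Formula.Realize,
    BoundedFormula.realize_restrictFreeVar (v' := Sum.elim v c)]
  rintro ⟨x | x, h⟩
  · simp [g]
  · simp [g]

/-- Existential quantification over an arbitrary family of variables. -/
theorem exists_exFormula {A B : Type*} (φ : L.Formula (A ⊕ B)) :
    ∃ ψ : L.Formula A, ∀ (N : Type u) [L.Structure N] [Nonempty N] (v : A → N),
      ψ.Realize v ↔ ∃ w : B → N, φ.Realize (Sum.elim v w) := by
  obtain ⟨n, φ', f, hf, h⟩ := exists_fin_params φ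
  refine ⟨Formula.iExs (Fin n) φ', fun N _ _ v => ?_⟩
  rw [Formula.realize_iExs]
  constructor
  · rintro ⟨i, hi⟩
    refine ⟨Function.extend f i (fun _ => Classical.arbitrary N), ?_⟩
    rwa [h, Function.extend_comp hf]
  · rintro ⟨w, hw⟩
    exact ⟨w ∘ f, (h N v w).1 hw⟩

theorem IsElemSubmodel.exists_realize {Ms : Set 𝕄} (hMs : IsElemSubmodel L Ms) [Nonempty 𝕄]
    {A B : Type*} (φ : L.Formula (A ⊕ B)) (m : A → 𝕄) (hm : ∀ i, m i ∈ Ms)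
    (h : ∃ w : B → 𝕄, φ.Realize (Sum.elim m w)) :
    ∃ w : B → 𝕄, (∀ i, w i ∈ Ms) ∧ φ.Realize (Sum.elim m w) := by
  obtain ⟨S, rfl⟩ := hMs
  have hne : Nonempty S := by
    infer_instance
  obtain ⟨ψ, hψ⟩ := exists_exFormula φ
  let m' : A → S := fun i => ⟨m i, hm i⟩
  have h1 : ψ.Realize m := (hψ 𝕄 m).2 h
  have h2 : ψ.Realize m' := by
    rw [← S.subtype.map_formula]
    exact h1
  obtain ⟨w, hw⟩ := (hψ S m').1 h2
  refine ⟨fun i => w i, fun i => (w i).2, ?_⟩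
  rw [← S.subtype.map_formula] at hw
  convert hw using 1
  ext x; cases x <;> rfl

theorem IsElemSubmodel.nonempty {Ms : Set 𝕄} (hMs : IsElemSubmodel L Ms) [Nonempty 𝕄] :
    Ms.Nonempty := by
  obtain ⟨w, hw, -⟩ := hMs.exists_realize (A := Empty) (B := Unit) ⊤ Empty.elim (fun i => i.elim)
    ⟨fun _ => Classical.arbitrary 𝕄, by simp⟩
  exact ⟨_, hw ()⟩

theorem EqTpOver.realize_iff {C : Set 𝕄} {A : Type v} {a b : A → 𝕄} (h : EqTpOver L C a b)
    {D : Type*} (χ : L.Formula (A ⊕ D)) (c : D → 𝕄) (hc : ∀ i, c i ∈ C) :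
    χ.Realize (Sum.elim a c) ↔ χ.Realize (Sum.elim b c) := by
  obtain ⟨n, χ', f, -, hχ⟩ := exists_fin_params χ
  rw [hχ, hχ]
  exact h n χ' _ fun i => hc _

theorem EqTpOver.refl (C : Set 𝕄) {A : Type v} (a : A → 𝕄) : EqTpOver L C a a :=
  fun _ _ _ _ => Iff.rfl

theorem EqTpOver.symm {C : Set 𝕄} {A : Type v} {a b : A → 𝕄} (h : EqTpOver L C a b) :
    EqTpOver L C b a :=
  fun n φ c hc => (h n φ c hc).symm

theorem EqTpOver.trans {C : Set 𝕄} {A : Type v} {a b d : A → 𝕄} (h : EqTpOver L C a b)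
    (h' : EqTpOver L C b d) : EqTpOver L C a d :=
  fun n φ c hc => (h n φ c hc).trans (h' n φ c hc)

theorem EqTpOver.mono {C D : Set 𝕄} {A : Type v} {a b : A → 𝕄} (h : EqTpOver L C a b)
    (hD : D ⊆ C) : EqTpOver L D a b :=
  fun n φ c hc => h n φ c fun i => hD (hc i)

/-- Types may be pushed forward along maps picking coordinates or parameters. -/
theorem EqTpOver.comp {C : Set 𝕄} {A : Type v} {B : Type w} {a b : A → 𝕄} (h : EqTpOver L C a b)
    (e : B → A) : EqTpOver L C (a ∘ e) (b ∘ e) := by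
  intro n φ c hc
  have := h n (φ.relabel (Sum.map e id)) c hc
  rw [Formula.realize_relabel, Formula.realize_relabel, Sum.elim_comp_map,
    Sum.elim_comp_map] at this
  simpa using this

theorem FinSatIn.exists_realize {Ms C : Set 𝕄} {A : Type v} {a : A → 𝕄} (h : FinSatIn L Ms a C)
    {D : Type*} (χ : L.Formula (A ⊕ D)) (c : D → 𝕄) (hc : ∀ i, c i ∈ C)
    (hχ : χ.Realize (Sum.elim a c)) :
    ∃ m : A → 𝕄, (∀ i, m i ∈ Ms) ∧ χ.Realize (Sum.elim m c) := by
  obtain ⟨n, χ', f, -, hχ'⟩ := exists_fin_params χ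
  obtain ⟨m, hm, hm'⟩ := h n χ' (c ∘ f) (fun i => hc _) ((hχ' _ _ _).1 hχ)
  exact ⟨m, hm, (hχ' _ _ _).2 hm'⟩

/-- The conjunction of a finite set of formulas. -/
theorem exists_conj {A : Type*} (t : Finset (L.Formula A)) :
    ∃ χ : L.Formula A, ∀ (N : Type u) [L.Structure N] (v : A → N),
      χ.Realize v ↔ ∀ φ ∈ t, φ.Realize v := by
  classical
  induction t using Finset.induction_on with
  | empty => exact ⟨⊤, fun N _ v => by simp⟩
  | insert φ t _ ih =>
    obtain ⟨χ, h⟩ := ih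
    exact ⟨φ ⊓ χ, fun N _ v => by simp [h]⟩

end FormulaLemmas

section Saturation

variable {L : FirstOrder.Language.{u, u}} {𝕄 : Type u} [L.Structure 𝕄] {κ : Cardinal.{u}}

theorem IsMonster.exists_realize (hM : IsMonster L 𝕄 κ) {A D : Type u}
    (hA : Cardinal.mk A < κ) (hD : Cardinal.mk D < κ) (d : D → 𝕄) (Γ : Set (L.Formula (A ⊕ D)))
    (h : ∀ t : Finset (L.Formula (A ⊕ D)), ↑t ⊆ Γ →
      ∃ a : A → 𝕄, ∀ χ ∈ t, χ.Realize (Sum.elim a d)) :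
    ∃ a : A → 𝕄, ∀ χ ∈ Γ, χ.Realize (Sum.elim a d) := by
  classical
  choose n χ' f _ hχ' using fun χ : L.Formula (A ⊕ D) => exists_fin_params χ
  let F : L.Formula (A ⊕ D) → FmlP L 𝕄 A := fun χ => ⟨n χ, χ' χ, d ∘ f χ⟩
  obtain ⟨a, ha⟩ := hM.2.1 A (Set.range d) hA (Cardinal.mk_range_le.trans_lt hD) (F '' Γ)
    (by rintro _ ⟨χ, -, rfl⟩ i; exact ⟨_, rfl⟩)
    (by
      intro t ht
      obtain ⟨s, hs, rfl⟩ := Finset.subset_set_image_iff.1 ht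
      obtain ⟨a, ha⟩ := h s hs
      refine ⟨a, fun p hp => ?_⟩
      obtain ⟨χ, hχ, rfl⟩ := Finset.mem_image.1 hp
      exact (hχ' χ _ _ _).1 (ha χ hχ))
  exact ⟨a, fun χ hχ => (hχ' χ _ _ _).2 (ha _ ⟨χ, hχ, rfl⟩)⟩

theorem IsMonster.exists_aut (hM : IsMonster L 𝕄 κ) {Ms : Set 𝕄} (hMs : Cardinal.mk Ms < κ)
    {A : Type u} (hA : Cardinal.mk A < κ) (a b : A → 𝕄) (h : EqTpOver L Ms a b) :
    ∃ σ : 𝕄 ≃[L] 𝕄, (∀ x ∈ Ms, σ x = x) ∧ σ ∘ a = b := by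
  obtain ⟨σ, hσ⟩ := hM.2.2 (A ⊕ Ms) (by
      rw [Cardinal.mk_sum, Cardinal.lift_id, Cardinal.lift_id]
      exact Cardinal.add_lt_of_lt hM.1.le hA hMs) (Sum.elim a Subtype.val) (Sum.elim b Subtype.val)
    (by
      intro n φ c hc
      have hn : IsEmpty (Fin n) := ⟨fun i => hc i⟩
      have := h.realize_iff (φ.relabel (Sum.elim id isEmptyElim)) Subtype.val (fun i => i.2)
      rw [Formula.realize_relabel, Formula.realize_relabel] at this
      convert this using 3 <;> ext x <;> rcases x with x | x <;> first | rfl | exact isEmptyElim x)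
  exact ⟨σ, fun x hx => hσ (Sum.inr ⟨x, hx⟩), funext fun i => hσ (Sum.inl i)⟩

end Saturation

section UltrafilterTypes

variable {L : FirstOrder.Language.{u, u}} {𝕄 : Type u} [L.Structure 𝕄] {κ : Cardinal.{u}}
  {Ms : Set 𝕄}

theorem exists_ultrafilter_of_directed {X ι : Type*} [hι : Nonempty ι] (S : ι → Set X)
    (hne : ∀ i, (S i).Nonempty) (hdir : ∀ i j, ∃ k, S k ⊆ S i ∩ S j) :
    ∃ U : Ultrafilter X, ∀ i, S i ∈ U := by
  have hn : (⨅ i, Filter.principal (S i)).NeBot := by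
    refine Filter.iInf_neBot_of_directed' ?_ fun i => Filter.principal_neBot_iff.2 (hne i)
    intro i j
    obtain ⟨k, hk⟩ := hdir i j
    exact ⟨k, Filter.principal_mono.2 fun x hx => (hk hx).1,
      Filter.principal_mono.2 fun x hx => (hk hx).2⟩
  refine ⟨Ultrafilter.of (⨅ i, Filter.principal (S i)), fun i => ?_⟩
  exact Ultrafilter.of_le (⨅ i, Filter.principal (S i)) (Filter.mem_iInf_of_mem i (Filter.mem_principal_self _))

/-- The ultrafilter `U` on tuples concentrates on tuples from `Ms`. -/
def USupp {γ : Type v} (U : Ultrafilter (γ → 𝕄)) (Ms : Set 𝕄) : Prop :=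
  ∀ᶠ m in (U : Filter (γ → 𝕄)), ∀ i, m i ∈ Ms

/-- `X` realizes over `C` the average type of the ultrafilter `U`. -/
def URealizes (L : FirstOrder.Language.{u, u}) {𝕄 : Type u} [L.Structure 𝕄] {γ : Type v}
    (U : Ultrafilter (γ → 𝕄)) (X : γ → 𝕄) (C : Set 𝕄) : Prop :=
  ∀ (n : ℕ) (χ : L.Formula (γ ⊕ Fin n)) (c : Fin n → 𝕄), (∀ i, c i ∈ C) →
    (∀ᶠ m in (U : Filter (γ → 𝕄)), χ.Realize (Sum.elim m c)) → χ.Realize (Sum.elim X c)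

/-- Substitute the coordinates of `X` and constants from `Ms` into a tuple. -/
def dpart {γ : Type v} {δ : Type w} (e : δ → γ ⊕ Ms) (X : γ → 𝕄) : δ → 𝕄 :=
  fun i => Sum.elim X Subtype.val (e i)

theorem URealizes.realize_iff {γ : Type v} {U : Ultrafilter (γ → 𝕄)} {X : γ → 𝕄} {C : Set 𝕄}
    (h : URealizes L U X C) {D : Type*} (χ : L.Formula (γ ⊕ D)) (c : D → 𝕄)
    (hc : ∀ i, c i ∈ C) :
    χ.Realize (Sum.elim X c) ↔ ∀ᶠ m in (U : Filter (γ → 𝕄)), χ.Realize (Sum.elim m c) := by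
  have key : ∀ χ : L.Formula (γ ⊕ D), (∀ᶠ m in (U : Filter (γ → 𝕄)), χ.Realize (Sum.elim m c)) →
      χ.Realize (Sum.elim X c) := by
    intro χ hχ
    obtain ⟨n, χ', f, -, hχ'⟩ := exists_fin_params χ
    rw [hχ']
    refine h n χ' _ (fun i => hc _) ?_
    filter_upwards [hχ] with m hm
    rwa [← hχ']
  refine ⟨fun h1 => ?_, key χ⟩
  by_contra h2
  rw [← Ultrafilter.eventually_not] at h2
  exact key χ.not (by simpa [Formula.realize_not] using h2) h1

theorem URealizes.mono {γ : Type v} {U : Ultrafilter (γ → 𝕄)} {X : γ → 𝕄} {C D : Set 𝕄}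
    (h : URealizes L U X C) (hD : D ⊆ C) : URealizes L U X D :=
  fun n χ c hc => h n χ c fun i => hD (hc i)

theorem URealizes.eqTpOver {γ : Type v} {U : Ultrafilter (γ → 𝕄)} {X Y : γ → 𝕄} {C : Set 𝕄}
    (h : URealizes L U X C) (h' : URealizes L U Y C) : EqTpOver L C X Y :=
  fun _ χ c hc => (h.realize_iff χ c hc).trans (h'.realize_iff χ c hc).symm

theorem URealizes.of_eqTpOver {γ : Type v} {U : Ultrafilter (γ → 𝕄)} {X Y : γ → 𝕄} {C : Set 𝕄}
    (h : URealizes L U X C) (h' : EqTpOver L C X Y) : URealizes L U Y C :=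
  fun n χ c hc hχ => (h' n χ c hc).1 (h n χ c hc hχ)

theorem URealizes.map {γ : Type v} {δ : Type w} {U : Ultrafilter (γ → 𝕄)} {X : γ → 𝕄} {C : Set 𝕄}
    (h : URealizes L U X C) (hC : Ms ⊆ C) (e : δ → γ ⊕ Ms) :
    URealizes L (U.map (dpart e)) (dpart e X) C := by
  intro n χ c hc hχ
  have hev : ∀ᶠ m in (U : Filter (γ → 𝕄)), χ.Realize (Sum.elim (dpart e m) c) := hχ
  let g : δ ⊕ Fin n → γ ⊕ (Ms ⊕ Fin n) :=
    Sum.elim (fun i => Sum.elim Sum.inl (Sum.inr ∘ Sum.inl) (e i)) (Sum.inr ∘ Sum.inr)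
  have hg : ∀ m : γ → 𝕄, Sum.elim m (Sum.elim (Subtype.val : Ms → 𝕄) c) ∘ g
      = Sum.elim (dpart e m) c := by
    intro m
    ext x
    rcases x with x | x
    · cases hx : e x <;> simp [g, dpart, hx]
    · simp [g]
  have := h.realize_iff (χ.relabel g) (Sum.elim (Subtype.val : Ms → 𝕄) c)
    (by rintro (i | i); exacts [hC i.2, hc i])
  simp only [Formula.realize_relabel, hg] at this
  exact this.2 hev

theorem URealizes.map_comp {γ : Type v} {δ : Type w} {U : Ultrafilter (γ → 𝕄)} {X : γ → 𝕄}
    {C : Set 𝕄} (h : URealizes L U X C) (e : δ → γ) :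
    URealizes L (U.map fun m => m ∘ e) (X ∘ e) C :=
  h.map (Ms := ∅) (Set.empty_subset _) (Sum.inl ∘ e)

theorem USupp.map {γ : Type v} {δ : Type w} {U : Ultrafilter (γ → 𝕄)} (h : USupp U Ms)
    (e : δ → γ ⊕ Ms) : USupp (U.map (dpart e)) Ms := by
  have : ∀ᶠ m in (U : Filter (γ → 𝕄)), ∀ i, dpart e m i ∈ Ms := by
    filter_upwards [h] with m hm i
    cases hx : e i with
    | inl x => simpa [dpart, hx] using hm x
    | inr x => simp [dpart, hx]
  exact this

theorem USupp.map_comp {γ : Type v} {δ : Type w} {U : Ultrafilter (γ → 𝕄)} (h : USupp U Ms)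
    (e : δ → γ) : USupp (U.map fun m => m ∘ e) Ms :=
  h.map (Sum.inl ∘ e)

theorem URealizes.aut {γ : Type v} {U : Ultrafilter (γ → 𝕄)} {X : γ → 𝕄} {C : Set 𝕄}
    (h : URealizes L U X C) (hU : USupp U Ms) (σ : 𝕄 ≃[L] 𝕄) (hσ : ∀ x ∈ Ms, σ x = x) :
    URealizes L U (σ ∘ X) (σ '' C) := by
  intro n χ c hc hχ
  choose c' hc' hcc using hc
  have e1 : ∀ Y : γ → 𝕄, Sum.elim (σ ∘ Y) c = σ ∘ Sum.elim Y c' := by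
    intro Y
    ext x
    cases x <;> simp [hcc]
  rw [e1, StrongHomClass.realize_formula, h.realize_iff _ _ hc']
  filter_upwards [hχ, hU] with m hm hm'
  rw [← StrongHomClass.realize_formula σ, ← e1]
  convert hm using 2
  ext i
  exact hσ _ (hm' i)

theorem IsMonster.exists_uRealizes (hM : IsMonster L 𝕄 κ) {γ : Type u} (hγ : Cardinal.mk γ < κ)
    (U : Ultrafilter (γ → 𝕄)) {C : Set 𝕄} (hC : Cardinal.mk C < κ) :
    ∃ X : γ → 𝕄, URealizes L U X C := by
  obtain ⟨X, hX⟩ := hM.exists_realize hγ hC (Subtype.val : C → 𝕄)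
    {χ | ∀ᶠ m in (U : Filter (γ → 𝕄)), χ.Realize (Sum.elim m (Subtype.val : C → 𝕄))}
    (by
      intro t ht
      have : ∀ᶠ m in (U : Filter (γ → 𝕄)), ∀ χ ∈ t,
          χ.Realize (Sum.elim m (Subtype.val : C → 𝕄)) :=
        (Filter.eventually_all_finset t).2 fun χ hχ => ht hχ
      exact this.exists)
  refine ⟨X, fun n χ c hc hχ => ?_⟩
  have key : ∀ Y : γ → 𝕄, Sum.elim Y (Subtype.val : C → 𝕄) ∘ Sum.map id (fun i => ⟨c i, hc i⟩)
      = Sum.elim Y c := by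
    intro Y
    ext x
    cases x <;> simp
  have := hX (χ.relabel (Sum.map id (fun i => ⟨c i, hc i⟩)))
    (by
      filter_upwards [hχ] with m hm
      rwa [Formula.realize_relabel, key])
  rwa [Formula.realize_relabel, key] at this

theorem GlobalType.exists_ultrafilter {γ : Type v} (q : GlobalType L 𝕄 γ) (h : q.FinSatInM Ms) :
    ∃ U : Ultrafilter (γ → 𝕄), USupp U Ms ∧
      ∀ (C : Set 𝕄) (X : γ → 𝕄), RealizesType q X C ↔ URealizes L U X C := by
  classical
  obtain ⟨U, hU⟩ := exists_ultrafilter_of_directed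
    (ι := {t : Finset (FmlP L 𝕄 γ) // (t : Set (FmlP L 𝕄 γ)) ⊆ q.carrier})
    (S := fun t => {m : γ → 𝕄 | (∀ i, m i ∈ Ms) ∧ ∀ p ∈ t.1, p.2.1.Realize (Sum.elim m p.2.2)})
    (hι := ⟨⟨∅, by simp⟩⟩)
    (fun t => h t.1 t.2)
    (fun s t => ⟨⟨s.1 ∪ t.1, by simpa using ⟨s.2, t.2⟩⟩, fun m hm =>
      ⟨⟨hm.1, fun p hp => hm.2 p (Finset.mem_union_left _ hp)⟩,
        ⟨hm.1, fun p hp => hm.2 p (Finset.mem_union_right _ hp)⟩⟩⟩)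
  have hq : ∀ p ∈ q.carrier, ∀ᶠ m in (U : Filter (γ → 𝕄)), p.2.1.Realize (Sum.elim m p.2.2) := by
    intro p hp
    filter_upwards [hU ⟨{p}, by simpa using hp⟩] with m hm
    exact hm.2 p (by simp)
  refine ⟨U, ?_, fun C X => ⟨fun hX n χ c hc hχ => ?_, fun hX n χ c hc hχ => ?_⟩⟩
  · filter_upwards [hU ⟨∅, by simp⟩] with m hm using hm.1
  · rcases q.complete n χ c with h1 | h1
    · exact hX n χ c hc h1
    · exfalso
      obtain ⟨m, hm1, hm2⟩ := ((hq _ h1).and hχ).exists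
      exact hm1 hm2
  · exact (hX.realize_iff χ c hc).2 (hq _ hχ)

theorem exists_globalType {γ : Type v} (U : Ultrafilter (γ → 𝕄)) (h : USupp U Ms) :
    ∃ q : GlobalType L 𝕄 γ, q.FinSatInM Ms ∧
      ∀ (C : Set 𝕄) (X : γ → 𝕄), RealizesType q X C ↔ URealizes L U X C := by
  have fin : ∀ t : Finset (FmlP L 𝕄 γ),
      ↑t ⊆ {p : FmlP L 𝕄 γ |
        ∀ᶠ m in (U : Filter (γ → 𝕄)), p.2.1.Realize (Sum.elim m p.2.2)} →
      ∃ m : γ → 𝕄, (∀ i, m i ∈ Ms) ∧ ∀ p ∈ t, p.2.1.Realize (Sum.elim m p.2.2) := by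
    intro t ht
    have : ∀ᶠ m in (U : Filter (γ → 𝕄)), ∀ p ∈ t, p.2.1.Realize (Sum.elim m p.2.2) :=
      (Filter.eventually_all_finset t).2 fun p hp => ht hp
    exact (Filter.Eventually.and h this).exists
  refine ⟨⟨{p | ∀ᶠ m in (U : Filter (γ → 𝕄)), p.2.1.Realize (Sum.elim m p.2.2)},
    fun t ht => (fin t ht).imp fun m hm => hm.2, fun n φ c => ?_⟩, fin, fun C X => Iff.rfl⟩
  rcases U.em fun m => φ.Realize (Sum.elim m c) with h1 | h1
  · exact Or.inl h1
  · exact Or.inr h1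

/-- Extend a coheir of `tp(X / Ms)` to a coheir of `tp(X c / Ms)`. -/
theorem exists_extend_ultrafilter [Nonempty 𝕄] (hMs : IsElemSubmodel L Ms) {A : Type v}
    {B : Type w} {V : Ultrafilter (A → 𝕄)} (hV : USupp V Ms) {X : A → 𝕄}
    (hX : URealizes L V X Ms) (c : B → 𝕄) :
    ∃ V' : Ultrafilter (A ⊕ B → 𝕄), USupp V' Ms ∧ V'.map (fun m => m ∘ Sum.inl) = V ∧
      URealizes L V' (Sum.elim X c) Ms := by
  have hasm : ∀ (m : A → 𝕄) (w : B → 𝕄),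
      Sum.elim (Sum.elim m (Subtype.val : Ms → 𝕄)) w ∘
        Sum.elim (Sum.map Sum.inl id) (Sum.inl ∘ Sum.inr) =
      Sum.elim (Sum.elim m w) (Subtype.val : Ms → 𝕄) := by
    intro m w
    ext x
    rcases x with (x | x) | x <;> simp
  obtain ⟨V', hV'⟩ := exists_ultrafilter_of_directed
    (ι := {s : Set (A → 𝕄) // s ∈ V} × {θ : L.Formula ((A ⊕ B) ⊕ Ms) //
      θ.Realize (Sum.elim (Sum.elim X c) (Subtype.val : Ms → 𝕄))})
    (S := fun i => {m : A ⊕ B → 𝕄 | m ∘ Sum.inl ∈ i.1.1 ∧ (∀ x, m x ∈ Ms) ∧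
      i.2.1.Realize (Sum.elim m (Subtype.val : Ms → 𝕄))})
    (hι := ⟨⟨⟨Set.univ, Filter.univ_mem⟩, ⟨⊤, by simp⟩⟩⟩)
    (by
      rintro ⟨⟨s, hs⟩, ⟨θ, hθ⟩⟩
      let θ' : L.Formula ((A ⊕ Ms) ⊕ B) :=
        θ.relabel (Sum.elim (Sum.map Sum.inl id) (Sum.inl ∘ Sum.inr))
      obtain ⟨ψ, hψ⟩ := exists_exFormula θ'
      have h1 : ψ.Realize (Sum.elim X (Subtype.val : Ms → 𝕄)) :=
        (hψ 𝕄 _).2 ⟨c, by rwa [Formula.realize_relabel, hasm]⟩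
      rw [hX.realize_iff ψ _ fun i => i.2] at h1
      obtain ⟨m, ⟨hm1, hm2⟩, hm3⟩ := ((h1.and hV).and hs).exists
      obtain ⟨w, hw1, hw2⟩ := hMs.exists_realize θ' (Sum.elim m (Subtype.val : Ms → 𝕄))
        (by rintro (i | i); exacts [hm2 i, i.2]) ((hψ 𝕄 _).1 hm1)
      refine ⟨Sum.elim m w, hm3, ?_, ?_⟩
      · rintro (i | i)
        exacts [hm2 i, hw1 i]
      · rwa [Formula.realize_relabel, hasm] at hw2)
    (fun i j => ⟨(⟨i.1.1 ∩ j.1.1, Filter.inter_mem i.1.2 j.1.2⟩,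
        ⟨i.2.1 ⊓ j.2.1, by simpa using ⟨i.2.2, j.2.2⟩⟩), fun m hm => by
        have h3 := hm.2.2
        rw [Formula.realize_inf] at h3
        exact ⟨⟨hm.1.1, hm.2.1, h3.1⟩, ⟨hm.1.2, hm.2.1, h3.2⟩⟩⟩)
  let top : {θ : L.Formula ((A ⊕ B) ⊕ Ms) //
      θ.Realize (Sum.elim (Sum.elim X c) (Subtype.val : Ms → 𝕄))} := ⟨⊤, by simp⟩
  refine ⟨V', ?_, ?_, fun n χ e he hχ => ?_⟩
  · filter_upwards [hV' (⟨Set.univ, Filter.univ_mem⟩, top)] with m hm using hm.2.1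
  · refine Ultrafilter.eq_of_le fun s hs => ?_
    have : ∀ᶠ m in (V' : Filter (A ⊕ B → 𝕄)), m ∘ Sum.inl ∈ s := by
      filter_upwards [hV' (⟨s, hs⟩, top)] with m hm using hm.1
    exact this
  · by_contra hn
    have key : ∀ Y : A ⊕ B → 𝕄,
        Sum.elim Y (Subtype.val : Ms → 𝕄) ∘ Sum.map id (fun i => ⟨e i, he i⟩)
        = Sum.elim Y e := by
      intro Y
      ext x
      cases x <;> simp
    have := hV' (⟨Set.univ, Filter.univ_mem⟩,
      ⟨χ.not.relabel (Sum.map id (fun i => ⟨e i, he i⟩)), by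
        rw [Formula.realize_relabel, key]; exact hn⟩)
    obtain ⟨m, hm1, hm2⟩ := (hχ.and this).exists
    have h3 := hm2.2.2
    rw [Formula.realize_relabel, key] at h3
    exact h3 hm1

end UltrafilterTypes

section MorleySequences

variable {L : FirstOrder.Language.{u, u}} {𝕄 : Type u} [L.Structure 𝕄] {κ : Cardinal.{u}}
  {Ms : Set 𝕄} {β : Type v}

/-- `Q 0, …, Q (n - 1)` is a Morley sequence over `C` in the sequence of ultrafilters `U`. -/
def MS (L : FirstOrder.Language.{u, u}) {𝕄 : Type u} [L.Structure 𝕄] {β : Type v}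
    (U : ℕ → Ultrafilter (β → 𝕄)) (C : Set 𝕄) (n : ℕ) (Q : ℕ → β → 𝕄) : Prop :=
  ∀ i < n, URealizes L (U i) (Q i) (C ∪ ⋃ (j : ℕ) (_ : j < i), Set.range (Q j))

theorem MS.le {U : ℕ → Ultrafilter (β → 𝕄)} {C : Set 𝕄} {m n : ℕ} {Q : ℕ → β → 𝕄}
    (h : MS L U C n Q) (hm : m ≤ n) : MS L U C m Q :=
  fun i hi => h i (hi.trans_le hm)

theorem MS.mono {U : ℕ → Ultrafilter (β → 𝕄)} {C D : Set 𝕄} {n : ℕ} {Q : ℕ → β → 𝕄}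
    (h : MS L U C n Q) (hD : D ⊆ C) : MS L U D n Q :=
  fun i hi => (h i hi).mono (Set.union_subset_union_left _ hD)

theorem MS.congr {U : ℕ → Ultrafilter (β → 𝕄)} {C : Set 𝕄} {n : ℕ} {Q Q' : ℕ → β → 𝕄}
    (h : MS L U C n Q) (hQ : ∀ i < n, Q i = Q' i) : MS L U C n Q' := by
  intro i hi
  have := h i hi
  rw [hQ i hi] at this
  refine this.mono (Set.union_subset_union_right _ ?_)
  refine Set.iUnion₂_mono fun j hj => ?_
  rw [hQ j (hj.trans hi)]

/-- Reindexing and shifting: dropping elements from a Morley sequence. -/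
theorem MS.subseq {U : ℕ → Ultrafilter (β → 𝕄)} {C : Set 𝕄} {m n : ℕ} {Q : ℕ → β → 𝕄}
    (h : MS L U C n Q) (g : ℕ → ℕ) (hg : ∀ i < m, g i < n) (hmono : ∀ i < m, ∀ j < i, g j < g i) :
    MS L (fun i => U (g i)) C m (fun i => Q (g i)) := by
  intro i hi
  refine (h (g i) (hg i hi)).mono (Set.union_subset_union_right _ ?_)
  refine Set.iUnion₂_subset fun j hj => ?_
  exact Set.subset_iUnion₂_of_subset (g j) (hmono i hi j hj) subset_rfl

/-- The tail of a Morley sequence is Morley over the initial part. -/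
theorem MS.tail {U : ℕ → Ultrafilter (β → 𝕄)} {C : Set 𝕄} {n : ℕ} {Q : ℕ → β → 𝕄} (k m : ℕ)
    (h : MS L U C n Q) (hk : k + m ≤ n) :
    MS L (fun i => U (k + i)) (C ∪ ⋃ (j : ℕ) (_ : j < k), Set.range (Q j)) m
      (fun i => Q (k + i)) := by
  intro i hi
  refine (h (k + i) (by omega)).mono ?_
  rw [Set.union_assoc]
  refine Set.union_subset_union_right _ (Set.union_subset ?_ ?_)
  · exact Set.iUnion₂_subset fun j hj => Set.subset_iUnion₂_of_subset j (by omega) subset_rfl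
  · exact Set.iUnion₂_subset fun j hj =>
      Set.subset_iUnion₂_of_subset (k + j) (by omega) subset_rfl

theorem MS.aut {U : ℕ → Ultrafilter (β → 𝕄)} {C : Set 𝕄} {n : ℕ} {Q : ℕ → β → 𝕄}
    (h : MS L U C n Q) (hU : ∀ i < n, USupp (U i) Ms) (σ : 𝕄 ≃[L] 𝕄) (hσ : ∀ x ∈ Ms, σ x = x) :
    MS L U (σ '' C) n (fun i => σ ∘ Q i) := by
  intro i hi
  refine ((h i hi).aut (hU i hi) σ hσ).mono ?_
  rw [Set.image_union, Set.image_iUnion₂]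
  refine Set.union_subset_union_right _ (Set.iUnion₂_mono fun j hj => ?_)
  rw [Set.range_comp]

theorem image_eq_of_fix {σ : 𝕄 ≃[L] 𝕄} (hσ : ∀ x ∈ Ms, σ x = x) : σ '' Ms = Ms := by
  ext x
  constructor
  · rintro ⟨y, hy, rfl⟩
    rwa [hσ y hy]
  · exact fun hx => ⟨x, hx, hσ x hx⟩

theorem MS.aut' {U : ℕ → Ultrafilter (β → 𝕄)} {n : ℕ} {Q : ℕ → β → 𝕄}
    (h : MS L U Ms n Q) (hU : ∀ i < n, USupp (U i) Ms) (σ : 𝕄 ≃[L] 𝕄) (hσ : ∀ x ∈ Ms, σ x = x) :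
    MS L U Ms n (fun i => σ ∘ Q i) := by
  have := h.aut hU σ hσ
  rwa [image_eq_of_fix hσ] at this

theorem MS.map {δ : Type w} {U : ℕ → Ultrafilter (β → 𝕄)} {C : Set 𝕄} {n : ℕ} {Q : ℕ → β → 𝕄}
    (h : MS L U C n Q) (hC : Ms ⊆ C) (e : δ → β ⊕ Ms) :
    MS L (fun i => (U i).map (dpart e)) C n (fun i => dpart e (Q i)) := by
  intro i hi
  refine ((h i hi).map (hC.trans Set.subset_union_left) e).mono ?_
  refine Set.union_subset Set.subset_union_left (Set.iUnion₂_subset fun j hj => ?_)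
  rintro _ ⟨x, rfl⟩
  cases hx : e x with
  | inl y =>
    refine Or.inr (Set.mem_iUnion₂.2 ⟨j, hj, y, ?_⟩)
    simp [dpart, hx]
  | inr y => exact Or.inl (hC (by simp [dpart, hx]))

theorem MS.map_comp {δ : Type w} {U : ℕ → Ultrafilter (β → 𝕄)} {C : Set 𝕄} {n : ℕ}
    {Q : ℕ → β → 𝕄} (h : MS L U C n Q) (e : δ → β) :
    MS L (fun i => (U i).map fun m => m ∘ e) C n (fun i => Q i ∘ e) :=
  h.map (Ms := ∅) (Set.empty_subset _) (Sum.inl ∘ e)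

theorem coheirMorley_iff {B : ℕ → β → 𝕄} :
    CoheirMorley L Ms B ↔
      ∃ U : Ultrafilter (β → 𝕄), USupp U Ms ∧ ∀ n, MS L (fun _ => U) Ms n B := by
  constructor
  · rintro ⟨q, hq, h⟩
    obtain ⟨U, hU, h'⟩ := q.exists_ultrafilter hq
    exact ⟨U, hU, fun n i _ => (h' _ _).1 (h i)⟩
  · rintro ⟨U, hU, h⟩
    obtain ⟨q, hq, h'⟩ := exists_globalType (L := L) U hU
    exact ⟨q, hq, fun i => (h' _ _).2 (h (i + 1) i i.lt_succ_self)⟩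

theorem mk_union_lt (hκ : Cardinal.aleph0 < κ) {C D : Set 𝕄} (hC : Cardinal.mk C < κ)
    (hD : Cardinal.mk D < κ) : Cardinal.mk (C ∪ D : Set 𝕄) < κ :=
  (Cardinal.mk_union_le _ _).trans_lt (Cardinal.add_lt_of_lt hκ.le hC hD)

theorem mk_nat_prod_lt (hκ : Cardinal.aleph0 < κ) {β : Type u} (hβ : Cardinal.mk β < κ) :
    Cardinal.mk (ℕ × β) < κ := by
  rw [Cardinal.mk_prod, Cardinal.lift_uzero]
  exact Cardinal.mul_lt_of_lt hκ.le (by simpa using hκ) hβ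

theorem mk_sum_lt (hκ : Cardinal.aleph0 < κ) {β γ : Type u} (hβ : Cardinal.mk β < κ)
    (hγ : Cardinal.mk γ < κ) : Cardinal.mk (β ⊕ γ) < κ := by
  rw [Cardinal.mk_sum, Cardinal.lift_id, Cardinal.lift_id]
  exact Cardinal.add_lt_of_lt hκ.le hβ hγ

theorem mk_range_lt {β : Type u} (hβ : Cardinal.mk β < κ) (X : β → 𝕄) :
    Cardinal.mk (Set.range X) < κ :=
  Cardinal.mk_range_le.trans_lt hβ

theorem mk_iUnion_range_lt (hκ : Cardinal.aleph0 < κ) {β : Type u} (hβ : Cardinal.mk β < κ)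
    (Q : ℕ → β → 𝕄) : Cardinal.mk (⋃ i, Set.range (Q i) : Set 𝕄) < κ := by
  refine lt_of_le_of_lt (Cardinal.mk_le_mk_of_subset ?_)
    (mk_range_lt (mk_nat_prod_lt hκ hβ) (flatSeq Q))
  refine Set.iUnion_subset fun i => ?_
  rintro _ ⟨x, rfl⟩
  exact ⟨(i, x), rfl⟩

theorem mk_lt_iUnion_range_lt (hκ : Cardinal.aleph0 < κ) {β : Type u} (hβ : Cardinal.mk β < κ)
    {i : ℕ} (Q : ∀ j < i, β → 𝕄) :
    Cardinal.mk (⋃ (j : ℕ) (h : j < i), Set.range (Q j h) : Set 𝕄) < κ := by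
  by_cases hne : Nonempty (β → 𝕄)
  · obtain ⟨X⟩ := hne
    refine lt_of_le_of_lt (Cardinal.mk_le_mk_of_subset ?_)
      (mk_iUnion_range_lt hκ hβ fun j => if h : j < i then Q j h else X)
    refine Set.iUnion₂_subset fun j hj => ?_
    refine Set.subset_iUnion_of_subset j ?_
    rw [dif_pos hj]
  · have : (⋃ (j : ℕ) (h : j < i), Set.range (Q j h) : Set 𝕄) = ∅ := by
      refine Set.eq_empty_of_subset_empty (Set.iUnion₂_subset fun j hj => ?_)
      exact (hne ⟨Q j hj⟩).elim
    rw [this, Cardinal.mk_eq_zero]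
    exact Cardinal.aleph0_pos.trans hκ

/-- Morley sequences exist, with a prescribed initial segment. -/
theorem IsMonster.exists_MS (hM : IsMonster L 𝕄 κ) {β : Type u} (hβ : Cardinal.mk β < κ)
    (U : ℕ → Ultrafilter (β → 𝕄)) {C : Set 𝕄} (hC : Cardinal.mk C < κ) (k : ℕ) (P : ℕ → β → 𝕄)
    (hP : MS L U C k P) :
    ∃ Q : ℕ → β → 𝕄, (∀ i < k, Q i = P i) ∧ ∀ n, MS L U C n Q := by
  choose X hX using fun (i : ℕ) (prev : ∀ j < i, β → 𝕄) =>
    hM.exists_uRealizes hβ (U i) (mk_union_lt hM.1 hC (mk_lt_iUnion_range_lt hM.1 hβ prev))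
  let F : ∀ i : ℕ, (∀ j < i, β → 𝕄) → β → 𝕄 := fun i prev => if i < k then P i else X i prev
  let Q : ℕ → β → 𝕄 := (wellFounded_lt (α := ℕ)).fix F
  have hQ : ∀ i, Q i = F i fun j _ => Q j := fun i => WellFounded.fix_eq _ _ _
  have hQP : ∀ i < k, Q i = P i := fun i hi => by rw [hQ]; simp [F, hi]
  refine ⟨Q, hQP, fun n i hi => ?_⟩
  by_cases hik : i < k
  · exact (hP.congr fun j hj => (hQP j hj).symm) i hik
  · have h1 : Q i = X i fun j _ => Q j := by rw [hQ]; simp [F, hik]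
    rw [h1]
    exact hX i fun j _ => Q j

/-- The ultrafilter on `ℕ`-sequences obtained as an iterated product of `U 0, …, U (n - 1)`,
with default values `m0`. -/
noncomputable def iterProd (U : ℕ → Ultrafilter (β → 𝕄)) (m0 : ℕ → β → 𝕄) :
    ℕ → Ultrafilter (ℕ → β → 𝕄)
  | 0 => pure m0
  | n + 1 => (U n).bind fun y => (iterProd U m0 n).map fun P => Function.update P n y

theorem iterProd_eventually {U : ℕ → Ultrafilter (β → 𝕄)} {m0 : ℕ → β → 𝕄} {C : Set 𝕄}
    (n : ℕ) (hU : ∀ i < n, USupp (U i) C) (hm0 : ∀ i x, m0 i x ∈ C) :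
    ∀ᶠ P in (iterProd U m0 n : Filter (ℕ → β → 𝕄)), ∀ i x, P i x ∈ C := by
  induction n with
  | zero => exact (Filter.eventually_pure (a := m0)).2 hm0
  | succ n ih =>
    have : ∀ᶠ y in (U n : Filter (β → 𝕄)), ∀ᶠ P in (iterProd U m0 n : Filter (ℕ → β → 𝕄)),
        ∀ i x, (Function.update P n y : ℕ → β → 𝕄) i x ∈ C := by
      filter_upwards [hU n n.lt_succ_self] with y hy
      filter_upwards [ih fun i hi => hU i (hi.trans n.lt_succ_self)] with P hP i x
      by_cases h : i = n
      · subst h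
        simpa using hy x
      · simpa [Function.update_of_ne h] using hP i x
    exact this

theorem MS.realize_iterProd {U : ℕ → Ultrafilter (β → 𝕄)} {m0 : ℕ → β → 𝕄} {C : Set 𝕄}
    (hm0 : ∀ i x, m0 i x ∈ C) (n : ℕ) (hU : ∀ i < n, USupp (U i) C) (Q : ℕ → β → 𝕄)
    (hQ : MS L U C n Q) (hQ0 : ∀ i, n ≤ i → Q i = m0 i) {D : Type v}
    (χ : L.Formula ((ℕ × β) ⊕ D)) (c : D → 𝕄) (hc : ∀ i, c i ∈ C) :
    χ.Realize (Sum.elim (flatSeq Q) c) ↔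
      ∀ᶠ P in (iterProd U m0 n : Filter (ℕ → β → 𝕄)), χ.Realize (Sum.elim (flatSeq P) c) := by
  classical
  induction n generalizing Q D with
  | zero =>
    have : Q = m0 := funext fun i => hQ0 i i.zero_le
    subst this
    exact (Filter.eventually_pure (a := Q)
      (p := fun P => χ.Realize (Sum.elim (flatSeq P) c))).symm
  | succ n ih =>
    let Q' := Function.update Q n (m0 n)
    have hQ' : MS L U C n Q' := (hQ.le n.le_succ).congr fun i hi =>
      (Function.update_of_ne hi.ne _ _).symm
    have hQ0' : ∀ i, n ≤ i → Q' i = m0 i := by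
      intro i hi
      by_cases h : i = n
      · subst h; simp [Q']
      · rw [show Q' i = Q i from Function.update_of_ne h _ _]
        exact hQ0 i (by omega)
    let g1 : (ℕ × β) ⊕ D → β ⊕ (D ⊕ (ℕ × β)) :=
      Sum.elim (fun p => if p.1 = n then Sum.inl p.2 else Sum.inr (Sum.inr p))
        (fun d => Sum.inr (Sum.inl d))
    let g2 : (ℕ × β) ⊕ D → (ℕ × β) ⊕ (D ⊕ β) :=
      Sum.elim (fun p => if p.1 = n then Sum.inr (Sum.inr p.2) else Sum.inl p)
        (fun d => Sum.inr (Sum.inl d))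
    have e1 : ∀ (y : β → 𝕄) (P : ℕ → β → 𝕄), Sum.elim y (Sum.elim c (flatSeq P)) ∘ g1
        = Sum.elim (flatSeq (Function.update P n y)) c := by
      intro y P
      ext x
      rcases x with ⟨i, x⟩ | x
      · by_cases h : i = n
        · subst h; simp [g1, flatSeq]
        · simp [g1, flatSeq, h]
      · simp [g1]
    have e2 : ∀ (y : β → 𝕄) (P : ℕ → β → 𝕄), Sum.elim (flatSeq P) (Sum.elim c y) ∘ g2
        = Sum.elim (flatSeq (Function.update P n y)) c := by
      intro y P
      ext x
      rcases x with ⟨i, x⟩ | x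
      · by_cases h : i = n
        · subst h; simp [g2, flatSeq]
        · simp [g2, flatSeq, h]
      · simp [g2]
    have e3 : Function.update Q' n (Q n) = Q := by simp [Q']
    have h1 := (hQ n n.lt_succ_self).realize_iff (χ.relabel g1) (Sum.elim c (flatSeq Q')) (by
      rintro (i | ⟨i, x⟩)
      · exact Or.inl (hc i)
      · by_cases h : n ≤ i
        · left
          change Q' i x ∈ C
          rw [hQ0' i h]
          exact hm0 i x
        · right
          refine Set.mem_iUnion₂.2 ⟨i, not_le.1 h, x, ?_⟩
          change Q i x = Q' i x
          rw [show Q' i = Q i from Function.update_of_ne (by omega) _ _])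
    simp only [Formula.realize_relabel, e1, e3] at h1
    rw [h1]
    change _ ↔ ∀ᶠ y in (U n : Filter (β → 𝕄)), ∀ᶠ P in (iterProd U m0 n : Filter (ℕ → β → 𝕄)),
      χ.Realize (Sum.elim (flatSeq (Function.update P n y)) c)
    have hUn : USupp (U n) C := hU n n.lt_succ_self
    refine Filter.eventually_congr ?_
    filter_upwards [hUn] with y hy
    have h2 := ih (fun i hi => hU i (hi.trans n.lt_succ_self)) Q' hQ' hQ0' (χ.relabel g2)
      (Sum.elim c y) (by rintro (i | i); exacts [hc i, hy i])
    simpa only [Formula.realize_relabel, e2] using h2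

/-- A finite Morley sequence realizes a fixed coheir. -/
theorem exists_block (hne : Ms.Nonempty) (U : ℕ → Ultrafilter (β → 𝕄)) (n : ℕ)
    (hU : ∀ i < n, USupp (U i) Ms) :
    ∃ V : Ultrafilter (Fin n × β → 𝕄), USupp V Ms ∧ ∀ (C : Set 𝕄) (Q : ℕ → β → 𝕄), Ms ⊆ C →
      MS L U C n Q → URealizes L V (fun p => Q p.1 p.2) C := by
  obtain ⟨m0, hm0⟩ := hne
  let tr : Fin n × β → ℕ × β := fun p => (p.1, p.2)
  refine ⟨(iterProd U (fun _ _ => m0) n).map fun P => flatSeq P ∘ tr, ?_, ?_⟩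
  · have := iterProd_eventually n hU (m0 := fun _ _ => m0) (fun _ _ => hm0)
    have : ∀ᶠ P in (iterProd U (fun _ _ => m0) n : Filter (ℕ → β → 𝕄)),
      ∀ i, (flatSeq P ∘ tr) i ∈ Ms := this.mono fun P hP i => hP _ _
    exact this
  · intro C Q hC hQ
    let Q' : ℕ → β → 𝕄 := fun i => if i < n then Q i else fun _ => m0
    have hQQ : (fun p : Fin n × β => Q p.1 p.2) = flatSeq Q' ∘ tr := by
      ext p
      simp [Q', flatSeq, tr]
    rw [hQQ]
    intro k χ c hc hχ
    have hev : ∀ᶠ P in (iterProd U (fun _ _ => m0) n : Filter (ℕ → β → 𝕄)),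
      χ.Realize (Sum.elim (flatSeq P ∘ tr) c) := hχ
    have key := MS.realize_iterProd (L := L) (m0 := fun _ _ => m0) (C := C)
      (fun _ _ => hC hm0) n
      (fun i hi => (hU i hi).mono fun m hm x => hC (hm x)) Q'
      (hQ.congr fun i hi => by simp [Q', hi])
      (fun i hi => by simp [Q', not_lt.2 hi]) (χ.relabel (Sum.map tr ULift.up))
      (c ∘ ULift.down) (fun i => hc _)
    simp only [Formula.realize_relabel, Sum.elim_comp_map] at key
    exact key.2 hev

theorem MS.eqTpOver [Nonempty 𝕄] (hne : Ms.Nonempty) {U : ℕ → Ultrafilter (β → 𝕄)} {n : ℕ}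
    (hU : ∀ i < n, USupp (U i) Ms) {C : Set 𝕄} {Q Q' : ℕ → β → 𝕄} (hC : Ms ⊆ C)
    (h : MS L U C n Q) (h' : MS L U C n Q') :
    EqTpOver L C (fun p : Fin n × β => Q p.1 p.2) (fun p : Fin n × β => Q' p.1 p.2) := by
  obtain ⟨V, -, hV⟩ := exists_block (L := L) hne U n hU
  exact (hV C Q hC h).eqTpOver (hV C Q' hC h')

/-- The type of an infinite sequence is determined by its finite initial segments. -/
theorem eqTpOver_flatSeq {C : Set 𝕄} {Q Q' : ℕ → β → 𝕄}
    (h : ∀ n, EqTpOver L C (fun p : Fin n × β => Q p.1 p.2) (fun p : Fin n × β => Q' p.1 p.2)) :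
    EqTpOver L C (flatSeq Q) (flatSeq Q') := by
  intro n φ c hc
  obtain ⟨k, χ, f, -, hχ⟩ := exists_fin_params (φ.relabel Sum.swap)
  have key : ∀ P : ℕ → β → 𝕄, φ.Realize (Sum.elim (flatSeq P) c) ↔
      χ.Realize (Sum.elim c (flatSeq P ∘ f)) := by
    intro P
    rw [← hχ, Formula.realize_relabel]
    congr!
    ext x
    cases x <;> rfl
  let N := (Finset.univ.sup fun i => (f i).1) + 1
  have hN : ∀ i, (f i).1 < N := fun i =>
    Nat.lt_succ_of_le (Finset.le_sup (f := fun i => (f i).1) (Finset.mem_univ i))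
  let g : Fin k → Fin N × β := fun i => (⟨(f i).1, hN i⟩, (f i).2)
  have := (h N).realize_iff (χ.relabel (Sum.elim Sum.inr (Sum.inl ∘ g))) c hc
  rw [key, key]
  simp only [Formula.realize_relabel] at this
  convert this using 2 <;> ext x <;> cases x <;> simp [flatSeq, g]

theorem MS.eqTpOver_flatSeq [Nonempty 𝕄] (hne : Ms.Nonempty) {U : ℕ → Ultrafilter (β → 𝕄)}
    (hU : ∀ i, USupp (U i) Ms) {C : Set 𝕄} {Q Q' : ℕ → β → 𝕄} (hC : Ms ⊆ C)
    (h : ∀ n, MS L U C n Q) (h' : ∀ n, MS L U C n Q') :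
    EqTpOver L C (flatSeq Q) (flatSeq Q') :=
  NSOP2Paper.eqTpOver_flatSeq fun n => MS.eqTpOver hne (fun i _ => hU i) hC (h n) (h' n)

end MorleySequences

section ConantIndependence

variable {L : FirstOrder.Language.{u, u}} {𝕄 : Type u} [L.Structure 𝕄] {κ : Cardinal.{u}}
  {Ms : Set 𝕄}

theorem exists_dpart {γ : Type v} {δ : Type w} (X : γ → 𝕄) (d : δ → 𝕄)
    (hd : ∀ i, d i ∈ Ms ∪ Set.range X) : ∃ e : δ → γ ⊕ Ms, dpart e X = d := by
  have : ∀ i, ∃ x : γ ⊕ Ms, Sum.elim X Subtype.val x = d i := by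
    intro i
    rcases hd i with h | ⟨x, hx⟩
    · exact ⟨Sum.inr ⟨_, h⟩, rfl⟩
    · exact ⟨Sum.inl x, hx⟩
  choose e he using this
  exact ⟨e, funext he⟩

theorem exists_dpart_flatSeq {β : Type v} {n : ℕ} (Q : ℕ → β → 𝕄) (d : Fin n → 𝕄)
    (hd : ∀ i, d i ∈ Ms ∪ Set.range (flatSeq Q)) :
    ∃ (k : ℕ) (e : Fin n → (Fin k × β) ⊕ Ms), dpart e (fun p => Q p.1 p.2) = d := by
  obtain ⟨e, he⟩ := exists_dpart (flatSeq Q) d hd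
  let N := (Finset.univ.sup fun i => Sum.elim (fun p => p.1) (fun _ => 0) (e i)) + 1
  have hN : ∀ i, Sum.elim (fun p => p.1) (fun _ => 0) (e i) < N := fun i =>
    Nat.lt_succ_of_le (Finset.le_sup (f := fun i => Sum.elim (fun p => p.1) (fun _ => 0) (e i))
      (Finset.mem_univ i))
  refine ⟨N, fun i => ?_, ?_⟩
  · exact Sum.map (fun p => (⟨min p.1 (N - 1), by omega⟩, p.2)) id (e i)
  · rw [← he]
    ext i
    have := hN i
    cases hx : e i with
    | inl p =>
      rw [hx] at this
      simp only [Sum.elim_inl] at this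
      simp only [dpart, hx, Sum.map_inl, Sum.elim_inl, flatSeq]
      rw [min_eq_left (by omega)]
    | inr x => simp [dpart, hx]

theorem dpart_aut {γ : Type v} {δ : Type w} (e : δ → γ ⊕ Ms) (X : γ → 𝕄) (σ : 𝕄 ≃[L] 𝕄)
    (hσ : ∀ x ∈ Ms, σ x = x) : dpart e (σ ∘ X) = σ ∘ dpart e X := by
  ext i
  cases hx : e i with
  | inl p => simp [dpart, hx]
  | inr x => simp [dpart, hx, hσ x.1 x.2]

theorem symm_fix {σ : 𝕄 ≃[L] 𝕄} (hσ : ∀ x ∈ Ms, σ x = x) : ∀ x ∈ Ms, σ.symm x = x := by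
  intro x hx
  conv_lhs => rw [← hσ x hx]
  exact σ.symm_apply_apply x

theorem realize_aut (σ : 𝕄 ≃[L] 𝕄) {A : Type v} {D : Type w} (χ : L.Formula (A ⊕ D)) (a : A → 𝕄)
    (d : D → 𝕄) : χ.Realize (Sum.elim (σ ∘ a) (σ ∘ d)) ↔ χ.Realize (Sum.elim a d) := by
  rw [← Sum.comp_elim, StrongHomClass.realize_formula]

theorem symm_comp_comp (σ : 𝕄 ≃[L] 𝕄) {A : Type v} (a : A → 𝕄) : σ.symm ∘ σ ∘ a = a := by
  ext i
  exact σ.symm_apply_apply _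

theorem comp_symm_comp (σ : 𝕄 ≃[L] 𝕄) {A : Type v} (a : A → 𝕄) : σ ∘ σ.symm ∘ a = a := by
  ext i
  exact σ.apply_symm_apply _

theorem eqTpOver_aut (σ : 𝕄 ≃[L] 𝕄) (hσ : ∀ x ∈ Ms, σ x = x) {A : Type v} (a : A → 𝕄) :
    EqTpOver L Ms a (σ ∘ a) := by
  intro n χ c hc
  rw [← realize_aut σ χ a c]
  congr!
  ext i
  exact hσ _ (hc i)

theorem eqTpOver_image (σ : 𝕄 ≃[L] 𝕄) {C : Set 𝕄} {A : Type v} {a b : A → 𝕄}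
    (h : EqTpOver L C a b) : EqTpOver L (σ '' C) (σ ∘ a) (σ ∘ b) := by
  intro n χ c hc
  have := h n χ (σ.symm ∘ c) (fun i => by
    obtain ⟨x, hx, hxc⟩ := hc i
    simp only [Function.comp, ← hxc]
    rwa [σ.symm_apply_apply])
  rw [← realize_aut σ, ← realize_aut σ χ b, comp_symm_comp] at this
  exact this

/-- Consecutive blocks of a Morley sequence form a Morley sequence. -/
theorem exists_blocks {β : Type v} (hne : Ms.Nonempty) {U : Ultrafilter (β → 𝕄)} (hU : USupp U Ms)
    {Q : ℕ → β → 𝕄} (hQ : ∀ n, MS L (fun _ => U) Ms n Q) (k : ℕ) :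
    ∃ V : Ultrafilter (Fin k × β → 𝕄), USupp V Ms ∧
      ∀ n, MS L (fun _ => V) Ms n (fun j p => Q (j * k + p.1) p.2) := by
  obtain ⟨V, hV, hV'⟩ := exists_block (L := L) hne (fun _ => U) k fun _ _ => hU
  refine ⟨V, hV, fun n j _ => hV' _ (fun i => Q (j * k + i)) Set.subset_union_left ?_⟩
  refine ((hQ (j * k + k)).tail (j * k) k le_rfl).mono ?_
  refine Set.union_subset_union_right _ (Set.iUnion₂_subset fun l hl => ?_)
  rintro _ ⟨⟨p, x⟩, rfl⟩
  refine Set.mem_iUnion₂.2 ⟨l * k + p, ?_, x, rfl⟩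
  calc l * k + p < l * k + k := by omega
    _ = (l + 1) * k := by ring
    _ ≤ j * k := Nat.mul_le_mul_right _ hl

theorem conantIndep_of_indiscernible [Nonempty 𝕄] (hM : IsMonster L 𝕄 κ)
    (hMs : IsElemSubmodel L Ms) (hMssmall : Cardinal.mk Ms < κ) {α β : Type u}
    (hβ : Cardinal.mk β < κ) (a : α → 𝕄) {U : Ultrafilter (β → 𝕄)}
    (hU : USupp U Ms) {I : ℕ → β → 𝕄} (hI : ∀ n, MS L (fun _ => U) Ms n I)
    (hind : IndiscernibleOver L (Ms ∪ Set.range a) I) :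
    ConantIndep L Ms a (flatSeq I) := by
  classical
  intro n φ d hd hφ ⟨N, m, ψ, c, hdiv, himp⟩
  obtain ⟨k, e, rfl⟩ := exists_dpart_flatSeq I d hd
  let blk : ℕ → Fin k × β → 𝕄 := fun j p => I (j * k + p.1) p.2
  have hblk0 : (fun p : Fin k × β => I p.1 p.2) = blk 0 := by
    ext p
    simp [blk]
  rw [hblk0] at himp hφ
  have hsat : ∀ j, φ.Realize (Sum.elim a (dpart e (blk j))) := by
    intro j
    let g : α ⊕ Fin n → (Fin k × β) ⊕ (α ⊕ Ms) :=
      Sum.elim (fun x => Sum.inr (Sum.inl x)) (fun i => Sum.map id Sum.inr (e i))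
    have hg : ∀ Y : Fin k × β → 𝕄, Sum.elim Y (Sum.elim a (Subtype.val : Ms → 𝕄)) ∘ g
        = Sum.elim a (dpart e Y) := by
      intro Y
      ext x
      rcases x with x | x
      · simp [g]
      · cases hx : e x <;> simp [g, dpart, hx]
    have := (hind k (fun i => (i : ℕ)) (fun i => j * k + i) (fun i j h => h)
      (fun i j h => by simpa using h)).realize_iff (φ.relabel g)
      (Sum.elim a (Subtype.val : Ms → 𝕄)) (by rintro (i | i); exacts [Or.inr ⟨i, rfl⟩, Or.inl i.2])
    rw [Formula.realize_relabel, Formula.realize_relabel, hg, hg, hblk0] at this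
    exact this.1 hφ
  obtain ⟨V, hV, hVblk⟩ := exists_blocks hMs.nonempty hU hI k
  let cc : (Σ j : Fin N, Fin (m j)) → 𝕄 := fun p => c p.1 p.2
  have hblk0V : URealizes L V (blk 0) Ms := (hVblk 1 0 one_pos).mono Set.subset_union_left
  obtain ⟨V', hV', hVV', hreal⟩ := exists_extend_ultrafilter hMs hV hblk0V cc
  have hsm : Cardinal.mk (Fin k × β) < κ := by
    rw [Cardinal.mk_prod, Cardinal.lift_uzero]
    exact Cardinal.mul_lt_of_lt hM.1.le (by simpa using (Cardinal.natCast_lt_aleph0).trans hM.1) hβ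
  have hsm' : Cardinal.mk ((Fin k × β) ⊕ (Σ j : Fin N, Fin (m j))) < κ := by
    rw [Cardinal.mk_sum]
    refine Cardinal.add_lt_of_lt hM.1.le (by simpa using hsm) ?_
    refine lt_trans ?_ hM.1
    rw [Cardinal.lift_lt_aleph0]
    exact Cardinal.lt_aleph0_of_finite _
  obtain ⟨Q, hQ0, hQ⟩ := hM.exists_MS hsm' (fun _ => V') hMssmall 1
    (fun _ => Sum.elim (blk 0) cc) (by
      intro i hi
      obtain rfl : i = 0 := by omega
      simpa using hreal)
  have hQblk : EqTpOver L Ms (flatSeq fun i => Q i ∘ Sum.inl) (flatSeq blk) := by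
    refine MS.eqTpOver_flatSeq hMs.nonempty (U := fun _ => V) (fun _ => hV) subset_rfl
      (fun n => ?_) hVblk
    have := (hQ n).map_comp Sum.inl
    simpa only [hVV'] using this
  obtain ⟨σ, hσ, hσQ⟩ := hM.exists_aut hMssmall (mk_nat_prod_lt hM.1 hsm) _ _ hQblk
  have hQ' : ∀ n, MS L (fun _ => V') Ms n (fun i => σ ∘ Q i) := fun n =>
    (hQ n).aut' (fun _ _ => hV') σ hσ
  have hQ'blk : ∀ i, (σ ∘ Q i) ∘ Sum.inl = blk i := by
    intro i
    ext x
    exact congrFun hσQ (i, x)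
  have hτ : ∀ i, ∃ τ : 𝕄 ≃[L] 𝕄, (∀ x ∈ Ms, τ x = x) ∧ τ ∘ Q 0 = σ ∘ Q i := by
    intro i
    refine hM.exists_aut hMssmall hsm' _ _ ?_
    refine URealizes.eqTpOver (U := V') ?_ ((hQ' (i + 1) i i.lt_succ_self).mono
      Set.subset_union_left)
    exact (hQ 1 0 one_pos).mono Set.subset_union_left
  have hψ : ∀ i, ∃ j, (ψ j).Realize (Sum.elim a (fun x => σ (Q i (Sum.inr ⟨j, x⟩)))) := by
    intro i
    obtain ⟨τ, hτ, hτQ⟩ := hτ i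
    have hb : τ.symm ∘ blk i = blk 0 := by
      rw [← hQ'blk i, ← hτQ, Function.comp_assoc, symm_comp_comp, hQ0 0 one_pos, Sum.elim_comp_inl]
    have h1 : φ.Realize (Sum.elim (τ.symm ∘ a) (dpart e (blk 0))) := by
      rw [← hb, dpart_aut e (blk i) τ.symm (symm_fix hτ), realize_aut]
      exact hsat i
    obtain ⟨j, hj⟩ := himp _ h1
    refine ⟨j, ?_⟩
    rw [← realize_aut τ, comp_symm_comp] at hj
    convert hj using 2
    ext x
    have := congrFun hτQ (Sum.inr ⟨j, x⟩)
    simp only [Function.comp] at this ⊢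
    rw [← this, hQ0 0 one_pos]
    rfl
  choose J hJ using hψ
  obtain ⟨j, hj⟩ := Finite.exists_infinite_fiber J
  let g := Nat.orderEmbeddingOfSet (J ⁻¹' {j})
  have hg : ∀ i, J (g i) = j := by
    intro i
    have : g i ∈ Set.range g := ⟨i, rfl⟩
    rw [Nat.orderEmbeddingOfSet_range] at this
    exact this
  obtain ⟨τ, hτ, hτQ⟩ := hτ (g 0)
  let B : ℕ → Fin (m j) → 𝕄 := fun i => τ.symm ∘ fun x => σ (Q (g i) (Sum.inr ⟨j, x⟩))
  refine hdiv j B ?_ ?_ ⟨τ.symm ∘ a, fun i => ?_⟩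
  · refine coheirMorley_iff.2 ⟨V'.map fun m => m ∘ fun x => Sum.inr ⟨j, x⟩,
      hV'.map_comp _, fun n => ?_⟩
    refine MS.aut' (Q := fun i x => σ (Q (g i) (Sum.inr ⟨j, x⟩))) ?_ (fun _ _ => hV'.map_comp _)
      τ.symm (symm_fix hτ)
    refine (MS.subseq (m := n) (hQ' (g n)) g (fun i hi => g.lt_iff_lt.2 hi)
      (fun i _ j hj => g.lt_iff_lt.2 hj)).map_comp fun x => Sum.inr ⟨j, x⟩
  · ext x
    have := congrFun hτQ (Sum.inr ⟨j, x⟩)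
    simp only [Function.comp] at this
    simp only [B, Function.comp]
    rw [← this, τ.symm_apply_apply, hQ0 0 one_pos]
    rfl
  · rw [realize_aut]
    have := hJ (g i)
    rw [hg] at this
    exact this

end ConantIndependence

section Extraction

variable {L : FirstOrder.Language.{u, u}} {𝕄 : Type u} [L.Structure 𝕄] {κ : Cardinal.{u}}
  {Ms : Set 𝕄}

theorem realize_update_iff {β : Type v} {D : Type w} {n : ℕ} (p : Fin n)
    {V : Ultrafilter (β → 𝕄)} {C : Set 𝕄} {P : Fin n → β → 𝕄} (hp : URealizes L V (P p) C)
    (hP : ∀ q, q ≠ p → ∀ x, P q x ∈ C) (hne : (Set.range (P p)).Nonempty → C.Nonempty)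
    (χ : L.Formula ((Fin n × β) ⊕ D)) (c : D → 𝕄) (hc : ∀ i, c i ∈ C) :
    χ.Realize (Sum.elim (fun r : Fin n × β => P r.1 r.2) c) ↔
      ∀ᶠ y in (V : Filter (β → 𝕄)),
        χ.Realize (Sum.elim (fun r : Fin n × β => Function.update P p y r.1 r.2) c) := by
  classical
  obtain ⟨y0, hy0⟩ : ∃ y0 : β → 𝕄, ∀ x, y0 x ∈ C := by
    rcases isEmpty_or_nonempty β with h | ⟨⟨x⟩⟩
    · exact ⟨h.elim, fun x => h.elim x⟩
    · obtain ⟨z, hz⟩ := hne ⟨_, x, rfl⟩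
      exact ⟨fun _ => z, fun _ => hz⟩
  let g : (Fin n × β) ⊕ D → β ⊕ (D ⊕ (Fin n × β)) :=
    Sum.elim (fun r => if r.1 = p then Sum.inl r.2 else Sum.inr (Sum.inr r))
      (fun d => Sum.inr (Sum.inl d))
  have e1 : ∀ y : β → 𝕄, Sum.elim y (Sum.elim c
        (fun r : Fin n × β => Function.update P p y0 r.1 r.2)) ∘ g
      = Sum.elim (fun r : Fin n × β => Function.update P p y r.1 r.2) c := by
    intro y
    ext x
    rcases x with ⟨i, x⟩ | x
    · by_cases h : i = p
      · subst h; simp [g]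
      · simp [g, h]
    · simp [g]
  have h1 := hp.realize_iff (χ.relabel g) (Sum.elim c
    (fun r : Fin n × β => Function.update P p y0 r.1 r.2)) (by
      rintro (i | ⟨q, x⟩)
      · exact hc i
      · by_cases h : q = p
        · subst h; simpa using hy0 x
        · simpa [h] using hP q h x)
  simpa only [Formula.realize_relabel, e1, Function.update_eq_self] using h1

/-- The reversal of a Morley sequence in the limit type of an indiscernible sequence `I` has
the same type as `I`. -/
theorem reverse_MS_realize {β : Type v} {I : ℕ → β → 𝕄} {C D : Set 𝕄} (hC : C.Nonempty)
    (hind : IndiscernibleOver L D I) (hD : D ⊆ C) (hIC : ∀ i x, I i x ∈ C) {n : ℕ}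
    {Q : ℕ → β → 𝕄}
    (hQ : MS L (fun _ => (Filter.hyperfilter ℕ : Ultrafilter ℕ).map I) C n Q) :
    EqTpOver L D (fun p : Fin n × β => Q (n - 1 - p.1) p.2) (fun p : Fin n × β => I p.1 p.2) := by
  have key : ∀ j k, k + j = n → ∀ f : ℕ → ℕ, (∀ p < k, ∀ q < p, f q < f p) →
      ∀ (m : ℕ) (χ : L.Formula ((Fin n × β) ⊕ Fin m)) (c : Fin m → 𝕄), (∀ i, c i ∈ D) →
      (χ.Realize (Sum.elim (fun r : Fin n × β =>
        (fun p : Fin n => if (p : ℕ) < k then I (f p) else Q (n - 1 - p)) r.1 r.2) c) ↔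
      χ.Realize (Sum.elim (fun r : Fin n × β => I r.1 r.2) c)) := by
    intro j
    induction j with
    | zero =>
      intro k hk f hf m χ c hc
      obtain rfl : k = n := by omega
      have := hind k (fun p => f p) (fun p => p) (fun p q h => hf q q.2 p h) (fun p q h => h)
        m χ c hc
      rw [← this]
      congr!
      simp
    | succ j ih =>
      intro k hk f hf m χ c hc
      have hkn : k < n := by omega
      rw [realize_update_iff (C := C ∪ ⋃ (l : ℕ) (_ : l < n - 1 - k), Set.range (Q l))
        (V := (Filter.hyperfilter ℕ : Ultrafilter ℕ).map I) (⟨k, hkn⟩ : Fin n)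
        (P := fun p : Fin n => if (p : ℕ) < k then I (f p) else Q (n - 1 - p))
        (by simpa using hQ (n - 1 - k) (by omega)) ?_ (fun _ => hC.mono Set.subset_union_left) χ c
        (fun i => Or.inl (hD (hc i)))]
      · have hb : ∃ b, ∀ p < k, f p < b := by
          refine ⟨(Finset.range k).sup f + 1, fun p hp => Nat.lt_succ_of_le ?_⟩
          exact Finset.le_sup (f := f) (Finset.mem_range.2 hp)
        obtain ⟨b, hb⟩ := hb
        have hev : ∀ᶠ i in ((Filter.hyperfilter ℕ : Ultrafilter ℕ) : Filter ℕ), b ≤ i :=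
          Nat.hyperfilter_le_atTop (Filter.eventually_ge_atTop b)
        change (∀ᶠ i in ((Filter.hyperfilter ℕ : Ultrafilter ℕ) : Filter ℕ), χ.Realize
          (Sum.elim (fun r : Fin n × β => Function.update (fun p : Fin n =>
            if (p : ℕ) < k then I (f p) else Q (n - 1 - p)) ⟨k, hkn⟩ (I i) r.1 r.2) c)) ↔ _
        have hcongr : ∀ᶠ i in ((Filter.hyperfilter ℕ : Ultrafilter ℕ) : Filter ℕ), (χ.Realize
          (Sum.elim (fun r : Fin n × β => Function.update (fun p : Fin n =>
            if (p : ℕ) < k then I (f p) else Q (n - 1 - p)) ⟨k, hkn⟩ (I i) r.1 r.2) c) ↔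
            χ.Realize (Sum.elim (fun r : Fin n × β => I r.1 r.2) c)) := by
          filter_upwards [hev] with i hi
          rw [← ih (k + 1) (by omega) (Function.update f k i) (by
            intro p hp q hq
            rcases Nat.lt_succ_iff_lt_or_eq.1 hp with h | rfl
            · rw [Function.update_of_ne (by omega), Function.update_of_ne (by omega)]
              exact hf p h q hq
            · rw [Function.update_of_ne (by omega), Function.update_self]
              exact (hb q hq).trans_le hi) m χ c hc]
          refine iff_of_eq (congrArg χ.Realize (congrArg (fun z => Sum.elim z c) (funext fun r => ?_)))
          by_cases h : r.1 = ⟨k, hkn⟩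
          · rw [h]
            simp
          · have h' : (r.1 : ℕ) ≠ k := fun h' => h (Fin.ext h')
            rw [Function.update_of_ne h]
            dsimp only
            by_cases h3 : (r.1 : ℕ) < k
            · simp [h3, h3.trans k.lt_succ_self, h']
            · rw [if_neg h3, if_neg (by omega)]
        rw [Filter.eventually_congr hcongr]
        simp
      · intro q hq x
        have h' : (q : ℕ) ≠ k := fun h' => hq (Fin.ext h')
        by_cases h3 : (q : ℕ) < k
        · simpa [h3] using Or.inl (hIC _ _)
        · simp only [h3, if_false]
          refine Or.inr (Set.mem_iUnion₂.2 ⟨n - 1 - q, by omega, x, rfl⟩)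
  intro m χ c hc
  have := key n 0 (by omega) id (by simp) m χ c hc
  simpa using this

/-- Extract from a sequence `I`, indiscernible over `D`, a sequence with the same type over `D`
which is indiscernible over the larger set `E`, every element of which realizes the type over
`E` shared by all elements of `I`. -/
theorem IsMonster.exists_indiscernible (hM : IsMonster L 𝕄 κ) {β : Type u}
    (hβ : Cardinal.mk β < κ) {D E : Set 𝕄} (hE : Cardinal.mk E < κ) (hDne : D.Nonempty)
    (hDE : D ⊆ E) {I : ℕ → β → 𝕄} (hind : IndiscernibleOver L D I) :
    ∃ J : ℕ → β → 𝕄, IndiscernibleOver L E J ∧ EqTpOver L D (flatSeq J) (flatSeq I) ∧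
      ∀ (n : ℕ) (χ : L.Formula (β ⊕ Fin n)) (c : Fin n → 𝕄), (∀ i, c i ∈ E) →
        (∀ i, χ.Realize (Sum.elim (I i) c)) → χ.Realize (Sum.elim (J 0) c) := by
  let C : Set 𝕄 := E ∪ ⋃ i, Set.range (I i)
  have hC : Cardinal.mk C < κ := mk_union_lt hM.1 hE (mk_iUnion_range_lt hM.1 hβ I)
  have hCne : C.Nonempty := hDne.mono (hDE.trans Set.subset_union_left)
  have hIC : ∀ i x, I i x ∈ C := fun i x => Or.inr (Set.mem_iUnion.2 ⟨i, x, rfl⟩)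
  let U : Ultrafilter (β → 𝕄) := (Filter.hyperfilter ℕ : Ultrafilter ℕ).map I
  have hU : USupp U C := by
    have : ∀ᶠ i in ((Filter.hyperfilter ℕ : Ultrafilter ℕ) : Filter ℕ), ∀ x, I i x ∈ C :=
      Filter.Eventually.of_forall hIC
    exact this
  obtain ⟨Q, -, hQ⟩ := hM.exists_MS hβ (fun _ => U) hC 0 (fun _ _ => hCne.some)
    (fun i hi => (Nat.not_lt_zero i hi).elim)
  let W : Ultrafilter (ℕ × β → 𝕄) := (Filter.hyperfilter ℕ : Ultrafilter ℕ).map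
    fun M => flatSeq fun i => Q (M - 1 - i)
  obtain ⟨X, hX⟩ := hM.exists_uRealizes (mk_nat_prod_lt hM.1 hβ) W hC
  have hXr : ∀ {m : ℕ} (χ : L.Formula ((ℕ × β) ⊕ Fin m)) (c : Fin m → 𝕄), (∀ i, c i ∈ C) →
      (χ.Realize (Sum.elim X c) ↔
        ∀ᶠ M in ((Filter.hyperfilter ℕ : Ultrafilter ℕ) : Filter ℕ),
          χ.Realize (Sum.elim (flatSeq fun i => Q (M - 1 - i)) c)) :=
    fun χ c hc => hX.realize_iff χ c hc
  have hge : ∀ b : ℕ, ∀ᶠ i in ((Filter.hyperfilter ℕ : Ultrafilter ℕ) : Filter ℕ), b ≤ i :=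
    fun b => Nat.hyperfilter_le_atTop (Filter.eventually_ge_atTop b)
  have hXn : ∀ (n : ℕ) (f : Fin n → ℕ), StrictMono f →
      EqTpOver L C (fun p : Fin n × β => X (f p.1, p.2))
        (fun p : Fin n × β => Q (n - 1 - p.1) p.2) := by
    intro n f hf m χ c hc
    let g : (Fin n × β) ⊕ Fin m → (ℕ × β) ⊕ Fin m := Sum.map (fun p => (f p.1, p.2)) id
    have h1 := hXr (χ.relabel g) c hc
    simp only [Formula.realize_relabel, g, Sum.elim_comp_map, Function.comp_id] at h1
    refine h1.trans ?_
    obtain ⟨b, hb⟩ : ∃ b, ∀ p, f p < b :=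
      ⟨Finset.univ.sup f + 1, fun p => Nat.lt_succ_of_le (Finset.le_sup (Finset.mem_univ p))⟩
    have hcongr : ∀ᶠ M in ((Filter.hyperfilter ℕ : Ultrafilter ℕ) : Filter ℕ),
        (χ.Realize (Sum.elim ((flatSeq fun i => Q (M - 1 - i)) ∘
          fun p : Fin n × β => (f p.1, p.2)) c) ↔
        χ.Realize (Sum.elim (fun p : Fin n × β => Q (n - 1 - p.1) p.2) c)) := by
      filter_upwards [hge b] with M hMb
      let f' : ℕ → ℕ := fun i => if h : n - 1 - i < n then M - 1 - f ⟨n - 1 - i, h⟩ else 0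
      have h2 : MS L (fun _ => U) C n (fun i => Q (f' i)) := by
        refine MS.subseq (m := n) (hQ M) f' ?_ ?_
        · intro i hi
          have h3 : n - 1 - i < n := by omega
          have := hb ⟨n - 1 - i, h3⟩
          simp only [f', h3, dif_pos]
          omega
        · intro i hi j hj
          have h3 : n - 1 - i < n := by omega
          have h4 : n - 1 - j < n := by omega
          have h5 := hb ⟨n - 1 - i, h3⟩
          have h6 := hb ⟨n - 1 - j, h4⟩
          have h7 : f ⟨n - 1 - i, h3⟩ < f ⟨n - 1 - j, h4⟩ :=
            hf (Fin.mk_lt_mk.2 (by omega))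
          simp only [f', h3, h4, dif_pos]
          omega
      have : Nonempty 𝕄 := ⟨hCne.some⟩
      have h3 := (MS.eqTpOver hCne (fun _ _ => hU) subset_rfl h2 (hQ n)).comp
        (fun p : Fin n × β => ((⟨n - 1 - p.1, by omega⟩ : Fin n), p.2)) m χ c hc
      convert h3 using 2
      · congr 1
        ext p
        have h4 : n - 1 - (n - 1 - (p.1 : ℕ)) = p.1 := by omega
        simp [flatSeq, f', h4, show (p.1 : ℕ) < n from p.1.2]
      · rfl
    rw [Filter.eventually_congr hcongr]
    simp
  let J : ℕ → β → 𝕄 := fun i x => X (i, x)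
  refine ⟨J, ?_, ?_, ?_⟩
  · intro n f g hf hg
    exact ((hXn n f hf).trans (hXn n g hg).symm).mono Set.subset_union_left
  · refine eqTpOver_flatSeq fun n => ?_
    refine EqTpOver.trans ((hXn n (fun i => i) fun i j h => h).mono
      (hDE.trans Set.subset_union_left)) ?_
    exact reverse_MS_realize hCne hind (hDE.trans Set.subset_union_left) hIC (hQ n)
  · intro n χ c hc hχ
    have h1 := (hXn 1 (fun i => i) (fun i j h => h)).comp (fun x : β => ((0 : Fin 1), x)) n χ c
      (fun i => Or.inl (hc i))
    have h2 : URealizes L U (Q 0) C := (hQ 1 0 one_pos).mono Set.subset_union_left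
    have h3 : χ.Realize (Sum.elim (Q 0) c) := by
      rw [h2.realize_iff χ c fun i => Or.inl (hc i)]
      have : ∀ᶠ i in ((Filter.hyperfilter ℕ : Ultrafilter ℕ) : Filter ℕ),
        χ.Realize (Sum.elim (I i) c) := Filter.Eventually.of_forall hχ
      exact this
    exact h1.2 h3

theorem EqTpOver.union_range {D : Set 𝕄} {A : Type v} {X Y : A → 𝕄} (h : EqTpOver L D X Y)
    {B : Type w} (e : B → A) (he : X ∘ e = Y ∘ e) :
    EqTpOver L (D ∪ Set.range (X ∘ e)) X Y := by
  intro n χ c hc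
  obtain ⟨d, hd⟩ := exists_dpart (Ms := D) (X ∘ e) c hc
  let g : A ⊕ Fin n → A ⊕ D := Sum.elim Sum.inl (fun i => Sum.map e id (d i))
  have hg : ∀ Z : A → 𝕄, Sum.elim Z (Subtype.val : D → 𝕄) ∘ g
      = Sum.elim Z (dpart d (Z ∘ e)) := by
    intro Z
    ext x
    rcases x with x | x
    · simp [g]
    · cases hx : d x <;> simp [g, dpart, hx]
  have := h.realize_iff (χ.relabel g) (Subtype.val : D → 𝕄) (fun i => i.2)
  rw [Formula.realize_relabel, Formula.realize_relabel, hg, hg, ← he, hd] at this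
  exact this

theorem MS.indiscernibleOver [Nonempty 𝕄] (hne : Ms.Nonempty) {β : Type v}
    {U : Ultrafilter (β → 𝕄)} (hU : USupp U Ms) {I : ℕ → β → 𝕄}
    (hI : ∀ n, MS L (fun _ => U) Ms n I) : IndiscernibleOver L Ms I := by
  have key : ∀ (n : ℕ) (f : Fin n → ℕ), StrictMono f →
      EqTpOver L Ms (fun p : Fin n × β => I (f p.1) p.2) (fun p : Fin n × β => I p.1 p.2) := by
    intro n f hf
    let f' : ℕ → ℕ := fun i => if h : i < n then f ⟨i, h⟩ else 0
    obtain ⟨b, hb⟩ : ∃ b, ∀ p, f p < b :=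
      ⟨Finset.univ.sup f + 1, fun p => Nat.lt_succ_of_le (Finset.le_sup (Finset.mem_univ p))⟩
    have h2 : MS L (fun _ => U) Ms n (fun i => I (f' i)) := by
      refine MS.subseq (m := n) (hI b) f' (fun i hi => ?_) fun i hi j hj => ?_
      · simpa [f', hi] using hb _
      · have hj' := hj.trans hi
        simp only [f', hi, hj', dif_pos]
        exact hf (Fin.mk_lt_mk.2 hj)
    have h3 := MS.eqTpOver hne (fun _ _ => hU) subset_rfl h2 (hI n)
    simpa [f'] using h3
  intro n f g hf hg
  exact (key n f hf).trans (key n g hg).symm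

/-- If every formula of `tp(a / Ms b)` is consistent along the Morley sequence `I` starting with
`b`, then there is `I' ≡_{Ms b} I` indiscernible over `Ms a`. -/
theorem exists_indiscernible_of_consistent [Nonempty 𝕄] (hM : IsMonster L 𝕄 κ)
    (hMs : IsElemSubmodel L Ms) (hMssmall : Cardinal.mk Ms < κ) {α β : Type u}
    (hα : Cardinal.mk α < κ) (hβ : Cardinal.mk β < κ) (a : α → 𝕄) (b : β → 𝕄)
    {U : Ultrafilter (β → 𝕄)} (hU : USupp U Ms) {I : ℕ → β → 𝕄}
    (hI : ∀ n, MS L (fun _ => U) Ms n I) (hI0 : I 0 = b)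
    (h : ∀ (n : ℕ) (φ : L.Formula (α ⊕ Fin n)) (e : Fin n → β ⊕ Ms),
      φ.Realize (Sum.elim a (dpart e b)) → ∃ a' : α → 𝕄, ∀ i,
        φ.Realize (Sum.elim a' (dpart e (I i)))) :
    ∃ I' : ℕ → β → 𝕄, EqTpOver L (Ms ∪ Set.range b) (flatSeq I') (flatSeq I) ∧
      IndiscernibleOver L (Ms ∪ Set.range a) I' := by
  classical
  have h' : ∀ χ : L.Formula (α ⊕ (β ⊕ Ms)), χ.Realize (Sum.elim a (Sum.elim b Subtype.val)) →
      ∃ a' : α → 𝕄, ∀ i, χ.Realize (Sum.elim a' (Sum.elim (I i) Subtype.val)) := by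
    intro χ hχ
    obtain ⟨n, χ', f, -, hχ'⟩ := exists_fin_params χ
    rw [hχ'] at hχ
    obtain ⟨a', ha'⟩ := h n χ' f hχ
    exact ⟨a', fun i => (hχ' _ _ _).2 (ha' i)⟩
  let g : ℕ → α ⊕ (β ⊕ Ms) → α ⊕ (Ms ⊕ (ℕ × β)) := fun i =>
    Sum.map id (Sum.elim (fun x => Sum.inr (i, x)) Sum.inl)
  have hg : ∀ i (a' : α → 𝕄), Sum.elim a' (Sum.elim (Subtype.val : Ms → 𝕄) (flatSeq I)) ∘ g i
      = Sum.elim a' (Sum.elim (I i) Subtype.val) := by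
    intro i a'
    ext x
    rcases x with x | x | x <;> simp [g, flatSeq]
  obtain ⟨a', ha'⟩ := hM.exists_realize (A := α) (D := Ms ⊕ (ℕ × β)) hα
    (mk_sum_lt hM.1 hMssmall (mk_nat_prod_lt hM.1 hβ))
    (Sum.elim (Subtype.val : Ms → 𝕄) (flatSeq I))
    {θ | ∃ (χ : L.Formula (α ⊕ (β ⊕ Ms))) (i : ℕ),
      χ.Realize (Sum.elim a (Sum.elim b Subtype.val)) ∧ θ = χ.relabel (g i)}
    (by
      intro t ht
      choose χ i hχ hθ using fun θ : t => ht θ.2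
      obtain ⟨ψ, hψ⟩ := exists_conj (Finset.univ.image χ)
      obtain ⟨a', ha'⟩ := h' ψ ((hψ 𝕄 _).2 (by
        intro φ hφ
        obtain ⟨θ, -, rfl⟩ := Finset.mem_image.1 hφ
        exact hχ θ))
      refine ⟨a', fun θ hθt => ?_⟩
      have e := hθ ⟨θ, hθt⟩
      dsimp only at e
      rw [e, Formula.realize_relabel, hg]
      exact (hψ 𝕄 _).1 (ha' _) _ (by simp))
  have ha'' : ∀ (χ : L.Formula (α ⊕ (β ⊕ Ms))) (i : ℕ),
      χ.Realize (Sum.elim a (Sum.elim b Subtype.val)) →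
      χ.Realize (Sum.elim a' (Sum.elim (I i) Subtype.val)) := by
    intro χ i hχ
    have := ha' _ ⟨χ, i, hχ, rfl⟩
    rwa [Formula.realize_relabel, hg] at this
  have hind := MS.indiscernibleOver hMs.nonempty hU hI
  obtain ⟨J, hJ1, hJ2, hJ3⟩ := hM.exists_indiscernible hβ (D := Ms) (E := Ms ∪ Set.range a')
    (mk_union_lt hM.1 hMssmall (mk_range_lt hα a')) hMs.nonempty Set.subset_union_left hind
  have hab : EqTpOver L Ms (Sum.elim a' (J 0)) (Sum.elim a b) := by
    have key : ∀ (n : ℕ) (χ : L.Formula ((α ⊕ β) ⊕ Fin n)) (c : Fin n → 𝕄), (∀ i, c i ∈ Ms) →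
        χ.Realize (Sum.elim (Sum.elim a b) c) → χ.Realize (Sum.elim (Sum.elim a' (J 0)) c) := by
      intro n χ c hc hχ
      have h1 : ∀ i, χ.Realize (Sum.elim (Sum.elim a' (I i)) c) := by
        intro i
        let k : (α ⊕ β) ⊕ Fin n → α ⊕ (β ⊕ Ms) :=
          Sum.elim (Sum.map id Sum.inl) (fun i => Sum.inr (Sum.inr ⟨c i, hc i⟩))
        have hk : ∀ (x : α → 𝕄) (y : β → 𝕄),
            Sum.elim x (Sum.elim y (Subtype.val : Ms → 𝕄)) ∘ k = Sum.elim (Sum.elim x y) c := by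
          intro x y
          ext z
          rcases z with (z | z) | z <;> simp [k]
        have := ha'' (χ.relabel k) i (by rwa [Formula.realize_relabel, hk])
        rwa [Formula.realize_relabel, hk] at this
      obtain ⟨m, χ', f, -, hχ'⟩ := exists_fin_params
        (χ.relabel (Sum.elim (Sum.elim (fun x => Sum.inr (Sum.inl x)) Sum.inl)
          (fun i => Sum.inr (Sum.inr i)) : (α ⊕ β) ⊕ Fin n → β ⊕ (α ⊕ Fin n)))
      have e1 : ∀ y : β → 𝕄, χ.Realize (Sum.elim (Sum.elim a' y) c) ↔
          χ'.Realize (Sum.elim y (Sum.elim a' c ∘ f)) := by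
        intro y
        rw [← hχ', Formula.realize_relabel]
        congr!
        ext z
        rcases z with (z | z) | z <;> simp
      rw [e1]
      refine hJ3 m χ' _ (fun i => ?_) fun i => (e1 _).1 (h1 i)
      rcases hfi : f i with x | x
      · exact Or.inr ⟨x, by simp [hfi]⟩
      · exact Or.inl (by simpa [hfi] using hc x)
    intro n χ c hc
    refine ⟨fun h1 => ?_, key n χ c hc⟩
    by_contra h2
    exact key n χ.not c hc h2 h1
  obtain ⟨σ, hσ, hσab⟩ := hM.exists_aut hMssmall (mk_sum_lt hM.1 hα hβ) _ _ hab
  have hσa : σ ∘ a' = a := by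
    ext x; exact congrFun hσab (Sum.inl x)
  have hσb : σ ∘ J 0 = b := by
    ext x; exact congrFun hσab (Sum.inr x)
  refine ⟨fun i => σ ∘ J i, ?_, ?_⟩
  · have h1 : EqTpOver L Ms (flatSeq fun i => σ ∘ J i) (flatSeq I) :=
      (eqTpOver_aut σ hσ (flatSeq J)).symm.trans hJ2
    have h2 := h1.union_range (fun x : β => (0, x)) (by
      change σ ∘ J 0 = I 0
      rw [hσb, hI0])
    have h3 : (flatSeq fun i => σ ∘ J i) ∘ (fun x : β => (0, x)) = b := hσb
    rwa [h3] at h2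
  · intro n f g hf hg
    have := eqTpOver_image σ (hJ1 n f g hf hg)
    rwa [Set.image_union, image_eq_of_fix hσ, ← Set.range_comp, hσa] at this

end Extraction

section TreeCompactness

variable {L : FirstOrder.Language.{u, u}} {𝕄 : Type u} [L.Structure 𝕄] {κ : Cardinal.{u}}
  {Ms : Set 𝕄}

theorem exists_jointlyConsistent_formula [Nonempty 𝕄] {A : Type v} {Y : Type w} {J : Type*}
    (θ : L.Formula (A ⊕ Y)) (S : Finset J) :
    ∃ ψ : L.Formula (ULift.{u} (J × Y)), ∀ b : J → Y → 𝕄,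
      ψ.Realize (fun p => b p.down.1 p.down.2) ↔
        ∃ a : A → 𝕄, ∀ s ∈ S, θ.Realize (Sum.elim a (b s)) := by
  classical
  let g : J → A ⊕ Y → ULift.{u} (J × Y) ⊕ A := fun s =>
    Sum.elim Sum.inr (fun y => Sum.inl ⟨s, y⟩)
  have hg : ∀ (s : J) (b : J → Y → 𝕄) (a : A → 𝕄),
      Sum.elim (fun p : ULift.{u} (J × Y) => b p.down.1 p.down.2) a ∘ g s
        = Sum.elim a (b s) := by
    intro s b a
    ext x
    rcases x with x | x <;> simp [g]
  obtain ⟨χ, hχ⟩ := exists_conj (S.image fun s => θ.relabel (g s))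
  obtain ⟨ψ, hψ⟩ := exists_exFormula χ
  refine ⟨ψ, fun b => ?_⟩
  rw [hψ]
  refine exists_congr fun a => ?_
  rw [hχ]
  simp only [Finset.forall_mem_image, Formula.realize_relabel, hg]

theorem exists_split_of_incomparable : ∀ η₁ η₂ : List Bool, ¬ η₁ <+: η₂ → ¬ η₂ <+: η₁ →
    ∃ μ η η', (η₁ = μ ++ false :: η ∧ η₂ = μ ++ true :: η') ∨
      (η₁ = μ ++ true :: η ∧ η₂ = μ ++ false :: η')
  | [], η₂, h, _ => (h ⟨_, rfl⟩).elim
  | _ :: _, [], _, h => (h ⟨_, rfl⟩).elim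
  | x :: η₁, y :: η₂, h, h' => by
    by_cases hxy : x = y
    · subst hxy
      obtain ⟨μ, η, η', H⟩ := exists_split_of_incomparable η₁ η₂
        (fun H => h (List.cons_prefix_cons.2 ⟨rfl, H⟩))
        (fun H => h' (List.cons_prefix_cons.2 ⟨rfl, H⟩))
      refine ⟨x :: μ, η, η', ?_⟩
      simpa using H
    · refine ⟨[], η₁, η₂, ?_⟩
      cases x <;> cases y <;> simp_all

/-- By compactness, arbitrarily deep finite trees suffice for `SOP₂`. -/
theorem hasSOP2_of_finite_trees_fin [Nonempty 𝕄] (hM : IsMonster L 𝕄 κ) {k m : ℕ}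
    (θ : L.Formula (Fin k ⊕ Fin m))
    (h : ∀ d : ℕ, ∃ b : List Bool → Fin m → 𝕄,
      (∀ σ : List Bool, σ.length = d → ∃ a : Fin k → 𝕄, ∀ l < d,
        θ.Realize (Sum.elim a (b (σ.take l)))) ∧
      ∀ μ η η' : List Bool, (μ ++ false :: η).length < d → (μ ++ true :: η').length < d →
        ¬ ∃ a : Fin k → 𝕄, θ.Realize (Sum.elim a (b (μ ++ false :: η))) ∧
          θ.Realize (Sum.elim a (b (μ ++ true :: η')))) : HasSOP2 L 𝕄 := by
  classical
  choose B hB1 hB2 using h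
  let A := ULift.{u} (List Bool × Fin m)
  have hcount : ∀ (X : Type) [Countable X], Cardinal.mk (ULift.{u} X) < κ := fun X _ =>
    (Cardinal.mk_le_aleph0_iff.2 inferInstance).trans_lt hM.1
  choose ψ hψ using fun S : Finset (List Bool) =>
    exists_jointlyConsistent_formula (𝕄 := 𝕄) θ S
  let Γ : Set (L.Formula (A ⊕ PEmpty.{u + 1})) := {χ | ∃ d0, ∀ d, d0 ≤ d →
    χ.Realize (Sum.elim (fun p : A => B d p.down.1 p.down.2) PEmpty.elim)}
  have hD : Cardinal.mk PEmpty.{u + 1} < κ := by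
    simpa using Cardinal.aleph0_pos.trans hM.1
  obtain ⟨b', hb'⟩ := hM.exists_realize (hcount _) hD (PEmpty.elim : PEmpty.{u + 1} → 𝕄) Γ (by
    intro t ht
    choose! d0 hd0 using ht
    exact ⟨_, fun χ hχ => hd0 hχ (t.sup d0) (Finset.le_sup hχ)⟩)
  let b : List Bool → Fin m → 𝕄 := fun s y => b' ⟨s, y⟩
  have e1 : ∀ (χ : L.Formula A) (v : A → 𝕄),
      (χ.relabel Sum.inl : L.Formula (A ⊕ PEmpty.{u + 1})).Realize (Sum.elim v PEmpty.elim) ↔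
        χ.Realize v := by
    intro χ v
    rw [Formula.realize_relabel, Sum.elim_comp_inl]
  have hΓ : ∀ χ : L.Formula A,
      (∃ d0, ∀ d, d0 ≤ d → χ.Realize fun p : A => B d p.down.1 p.down.2) →
      χ.Realize fun p : A => b p.down.1 p.down.2 := by
    rintro χ ⟨d0, hd0⟩
    exact (e1 _ _).1 (hb' (χ.relabel Sum.inl) ⟨d0, fun d hd => (e1 _ _).2 (hd0 d hd)⟩)
  have hpath : ∀ σ : List Bool, ∃ a : Fin k → 𝕄, ∀ l ≤ σ.length,
      θ.Realize (Sum.elim a (b (σ.take l))) := by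
    intro σ
    have := (hψ ((Finset.range (σ.length + 1)).image fun l => σ.take l) b).1
      (hΓ _ ⟨σ.length + 1, fun d hd => (hψ _ _).2 ?_⟩)
    · obtain ⟨a, ha⟩ := this
      exact ⟨a, fun l hl => ha _ (Finset.mem_image_of_mem _ (Finset.mem_range.2 (by omega)))⟩
    · obtain ⟨a, ha⟩ := hB1 d (σ ++ List.replicate (d - σ.length) false) (by
        rw [List.length_append, List.length_replicate]; omega)
      refine ⟨a, ?_⟩
      intro s hs
      obtain ⟨l, hl, rfl⟩ := Finset.mem_image.1 hs
      have hl' := Finset.mem_range.1 hl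
      have := ha l (by omega)
      rwa [List.take_append_of_le_length (by omega)] at this
  have hinc : ∀ μ η η' : List Bool, ¬ ∃ a : Fin k → 𝕄,
      θ.Realize (Sum.elim a (b (μ ++ false :: η))) ∧
        θ.Realize (Sum.elim a (b (μ ++ true :: η'))) := by
    rintro μ η η' ⟨a, ha1, ha2⟩
    have h1 := hΓ (ψ {μ ++ false :: η, μ ++ true :: η'}).not
      ⟨(μ ++ false :: η).length + (μ ++ true :: η').length + 1, fun d hd => by
        rw [Formula.realize_not, hψ]
        rintro ⟨a, ha⟩
        exact hB2 d μ η η' (by omega) (by omega) ⟨a, ha _ (by simp), ha _ (by simp)⟩⟩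
    rw [Formula.realize_not, hψ] at h1
    refine h1 ⟨a, fun s hs => ?_⟩
    rcases Finset.mem_insert.1 hs with rfl | hs
    · exact ha1
    · rwa [Finset.mem_singleton.1 hs]
  refine ⟨k, m, θ, b, fun σ => ?_, fun η₁ η₂ h1 h2 => ?_⟩
  · let g : ℕ → Fin k ⊕ Fin m → ULift.{u} (Fin k) ⊕ A := fun n =>
      Sum.map ULift.up fun y => ⟨List.ofFn fun i : Fin n => σ i, y⟩
    have hg : ∀ n (a : ULift.{u} (Fin k) → 𝕄), Sum.elim a b' ∘ g n
        = Sum.elim (a ∘ ULift.up) (b (List.ofFn fun i : Fin n => σ i)) := by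
      intro n a
      ext x
      rcases x with x | x <;> simp [g, b]
    obtain ⟨a, ha⟩ := hM.exists_realize (hcount (Fin k)) (hcount (List Bool × Fin m)) b'
      {χ | ∃ n, χ = θ.relabel (g n)} (by
        intro t ht
        have ht' : ∀ χ ∈ t, ∃ n, χ = θ.relabel (g n) := fun χ hχ => ht hχ
        choose! n hn using ht'
        obtain ⟨a, ha⟩ := hpath (List.ofFn fun i : Fin (t.sup n) => σ i)
        refine ⟨a ∘ ULift.down, fun χ hχ => ?_⟩
        have hle : n χ ≤ t.sup n := Finset.le_sup hχ
        have h3 := ha (n χ) (by simpa using hle)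
        have h4 : (List.ofFn fun i : Fin (t.sup n) => σ i).take (n χ)
            = List.ofFn fun i : Fin (n χ) => σ i := by
          apply List.ext_getElem
          · simpa using hle
          · intro i h5 h6
            simp
        rw [h4] at h3
        rw [hn χ hχ, Formula.realize_relabel, hg]
        exact h3)
    refine ⟨a ∘ ULift.up, fun n => ?_⟩
    have := ha _ ⟨n, rfl⟩
    rwa [Formula.realize_relabel, hg] at this
  · obtain ⟨μ, η, η', ⟨rfl, rfl⟩ | ⟨rfl, rfl⟩⟩ := exists_split_of_incomparable η₁ η₂ h1 h2
    · exact hinc μ η η'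
    · rintro ⟨a, ha1, ha2⟩
      exact hinc μ η' η ⟨a, ha2, ha1⟩

theorem hasSOP2_of_finite_trees [Nonempty 𝕄] (hM : IsMonster L 𝕄 κ) {A : Type v} {Y : Type w}
    [Finite Y] (ψ : L.Formula (A ⊕ Y))
    (h : ∀ d : ℕ, ∃ b : List Bool → Y → 𝕄,
      (∀ σ : List Bool, σ.length = d → ∃ a : A → 𝕄, ∀ l < d,
        ψ.Realize (Sum.elim a (b (σ.take l)))) ∧
      ∀ μ η η' : List Bool, (μ ++ false :: η).length < d → (μ ++ true :: η').length < d →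
        ¬ ∃ a : A → 𝕄, ψ.Realize (Sum.elim a (b (μ ++ false :: η))) ∧
          ψ.Realize (Sum.elim a (b (μ ++ true :: η')))) : HasSOP2 L 𝕄 := by
  obtain ⟨m, ⟨y⟩⟩ := Finite.exists_equiv_fin Y
  obtain ⟨k, χ, f, hf, hχ⟩ := exists_fin_params
    (ψ.relabel (Sum.elim Sum.inr (fun i => Sum.inl (y i)) : A ⊕ Y → Fin m ⊕ A))
  have e1 : ∀ (a : A → 𝕄) (c : Fin m → 𝕄), ψ.Realize (Sum.elim a (c ∘ y)) ↔
      (χ.relabel (Sum.swap : Fin m ⊕ Fin k → Fin k ⊕ Fin m)).Realize (Sum.elim (a ∘ f) c) := by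
    intro a c
    have h1 := hχ 𝕄 c a
    rw [Formula.realize_relabel] at h1
    have h2 : Sum.elim c a ∘ (Sum.elim Sum.inr (fun i => Sum.inl (y i)) : A ⊕ Y → Fin m ⊕ A)
        = Sum.elim a (c ∘ y) := by
      ext x
      rcases x with x | x <;> simp
    have h3 : Sum.elim (a ∘ f) c ∘ (Sum.swap : Fin m ⊕ Fin k → Fin k ⊕ Fin m)
        = Sum.elim c (a ∘ f) := by
      ext x
      rcases x with x | x <;> simp
    rw [h2] at h1
    rw [Formula.realize_relabel, h3]
    exact h1
  refine hasSOP2_of_finite_trees_fin hM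
    (χ.relabel (Sum.swap : Fin m ⊕ Fin k → Fin k ⊕ Fin m)) fun d => ?_
  obtain ⟨b, hb1, hb2⟩ := h d
  have hb : ∀ s, b s = (b s ∘ y.symm) ∘ y := by
    intro s
    ext x
    simp
  refine ⟨fun s => b s ∘ y.symm, fun σ hσ => ?_, ?_⟩
  · obtain ⟨a, ha⟩ := hb1 σ hσ
    refine ⟨a ∘ f, fun l hl => ?_⟩
    rw [← e1, ← hb]
    exact ha l hl
  · rintro μ η η' h1 h2 ⟨a, ha1, ha2⟩
    let a' : A → 𝕄 := Function.extend f a fun _ => Classical.arbitrary 𝕄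
    have ha' : a' ∘ f = a := Function.extend_comp hf _ _
    rw [← ha', ← e1, ← hb] at ha1 ha2
    exact hb2 μ η η' h1 h2 ⟨a', ha1, ha2⟩

end TreeCompactness

section CanonicalTrees

variable {L : FirstOrder.Language.{u, u}} {𝕄 : Type u} [L.Structure 𝕄] {κ : Cardinal.{u}}
  {Ms : Set 𝕄} {β : Type u}

/-- The tuple `E` can be moved over `Ms` so that any given small tuple is `R`-independent from it
and all of its subtuples picked out by `𝒩` realize the average type of `U`. -/
def CanonicalExt (R : IndRel L 𝕄) (κ : Cardinal.{u}) (Ms : Set 𝕄) (U : Ultrafilter (β → 𝕄))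
    {Γ : Type u} (𝒩 : Set (β → Γ)) (E : Γ → 𝕄) : Prop :=
  ∀ (δ : Type u), Cardinal.mk δ < κ → ∀ B : δ → 𝕄, ∃ E' : Γ → 𝕄, EqTpOver L Ms E' E ∧
    R.rel (Set.range B) Ms (Set.range E') ∧
    ∀ ν ∈ 𝒩, URealizes L U (E' ∘ ν) (Ms ∪ Set.range B)

theorem CanonicalExt.of_canonical (hM : IsMonster L 𝕄 κ) {R : IndRel L 𝕄}
    (hMssmall : Cardinal.mk Ms < κ) (hβ : Cardinal.mk β < κ) {U : Ultrafilter (β → 𝕄)}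
    (hcan : ∀ (δ : Type u), Cardinal.mk δ < κ → ∀ (B : δ → 𝕄) (c : β → 𝕄),
      URealizes L U c (Ms ∪ Set.range B) → R.rel (Set.range B) Ms (Set.range c))
    {b : β → 𝕄} (hb : URealizes L U b Ms) : CanonicalExt R κ Ms U {id} b := by
  intro δ hδ B
  obtain ⟨c, hc⟩ := hM.exists_uRealizes hβ U (mk_union_lt hM.1 hMssmall (mk_range_lt hδ B))
  refine ⟨c, (hc.mono Set.subset_union_left).eqTpOver hb, hcan δ hδ B c hc, ?_⟩
  rintro ν rfl
  exact hc

theorem CanonicalExt.uRealizes (hM : IsMonster L 𝕄 κ) {R : IndRel L 𝕄}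
    {U : Ultrafilter (β → 𝕄)} {Γ : Type u} {𝒩 : Set (β → Γ)} {E : Γ → 𝕄}
    (h : CanonicalExt R κ Ms U 𝒩 E) {ν : β → Γ} (hν : ν ∈ 𝒩) : URealizes L U (E ∘ ν) Ms := by
  obtain ⟨E', hE', -, hE'ν⟩ := h PEmpty (by simpa using Cardinal.aleph0_pos.trans hM.1)
    PEmpty.elim
  exact ((hE'ν ν hν).mono Set.subset_union_left).of_eqTpOver (hE'.comp ν)

theorem CanonicalExt.comp {R : IndRel L 𝕄} {U : Ultrafilter (β → 𝕄)} {Γ Γ' : Type u}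
    {𝒩 : Set (β → Γ)} {E : Γ → 𝕄} (h : CanonicalExt R κ Ms U 𝒩 E) {f : Γ' → Γ}
    (hf : Function.Surjective f) : CanonicalExt R κ Ms U {ν | f ∘ ν ∈ 𝒩} (E ∘ f) := by
  intro δ hδ B
  obtain ⟨E', hE', hR, hν⟩ := h δ hδ B
  refine ⟨E' ∘ f, hE'.comp f, ?_, fun ν h => hν _ h⟩
  rwa [hf.range_comp]

theorem CanonicalExt.flatSeq (hM : IsMonster L 𝕄 κ) {R : IndRel L 𝕄} (hR : R.CoheirChain κ)
    (hMs : IsElemSubmodel L Ms) (hMssmall : Cardinal.mk Ms < κ)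
    {U : Ultrafilter (β → 𝕄)} {Γ : Type u} (hΓ : Cardinal.mk Γ < κ)
    {𝒩 : Set (β → Γ)} {E : Γ → 𝕄} (h : CanonicalExt R κ Ms U 𝒩 E)
    {V : Ultrafilter (Γ → 𝕄)} (hV : USupp V Ms) {Q : ℕ → Γ → 𝕄}
    (hQ : ∀ n, MS L (fun _ => V) Ms n Q) (hQ0 : Q 0 = E) :
    CanonicalExt R κ Ms U {ν' | ∃ i, ∃ ν ∈ 𝒩, ν' = fun x => (i, ν x)} (flatSeq Q) := by
  intro δ hδ B
  obtain ⟨E', hE', hrel, hν⟩ := h δ hδ B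
  obtain ⟨σ, hσ, hσE⟩ := hM.exists_aut hMssmall hΓ _ _ hE'.symm
  obtain ⟨I', hI', hrel', hI'E⟩ := hR Ms hMs hMssmall δ Γ hδ hΓ B E' hrel (fun i => σ ∘ Q i)
    (coheirMorley_iff.2 ⟨V, hV, fun n => (hQ n).aut' (fun _ _ => hV) σ hσ⟩)
    (by rw [hQ0, hσE])
  refine ⟨NSOP2Paper.flatSeq I', hI'.trans (eqTpOver_aut σ hσ (NSOP2Paper.flatSeq Q)).symm, ?_, ?_⟩
  · have : Set.range (NSOP2Paper.flatSeq I') = ⋃ i, Set.range (I' i) := by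
      ext x
      simp [NSOP2Paper.flatSeq]
    rwa [this]
  · rintro ν' ⟨i, ν, h1, rfl⟩
    exact (hν ν h1).of_eqTpOver ((hI'E i).symm.comp ν)

theorem CanonicalExt.exists_ultrafilter (hM : IsMonster L 𝕄 κ) {R : IndRel L 𝕄}
    (hR : R.StrongerThanH) (hMs : IsElemSubmodel L Ms)
    {U : Ultrafilter (β → 𝕄)} {Γ : Type u}
    {𝒩 : Set (β → Γ)} {E : Γ → 𝕄} (h : CanonicalExt R κ Ms U 𝒩 E) :
    ∃ V : Ultrafilter (Γ → 𝕄), USupp V Ms ∧ URealizes L V E Ms ∧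
      ∀ ν ∈ 𝒩, ∀ (C : Set 𝕄) (X : Γ → 𝕄), URealizes L V X C → URealizes L U (X ∘ ν) C := by
  classical
  let T : Set (FmlP L 𝕄 Γ) := {p | ((∀ i, p.2.2 i ∈ Ms) ∧ p.2.1.Realize (Sum.elim E p.2.2)) ∨
    ∃ ν ∈ 𝒩, ∃ θ : L.Formula (β ⊕ Fin p.1), p.2.1 = θ.relabel (Sum.map ν id) ∧
      ∀ᶠ m in (U : Filter (β → 𝕄)), θ.Realize (Sum.elim m p.2.2)}
  let S : {t : Finset (FmlP L 𝕄 Γ) // ↑t ⊆ T} → Set (Γ → 𝕄) := fun t =>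
    {m | (∀ i, m i ∈ Ms) ∧ ∀ p ∈ t.1, p.2.1.Realize (Sum.elim m p.2.2)}
  have hne : Nonempty {t : Finset (FmlP L 𝕄 Γ) // ↑t ⊆ T} := ⟨∅, by simp⟩
  obtain ⟨V, hV⟩ := exists_ultrafilter_of_directed S (by
    rintro ⟨t, ht⟩
    let δ := Σ p : t, Fin p.1.1
    let B : δ → 𝕄 := fun i => i.1.1.2.2 i.2
    obtain ⟨E', hE', hrel, hν⟩ := h δ ((Cardinal.mk_lt_aleph0_iff.2 inferInstance).trans hM.1) B
    have hE'p : ∀ p ∈ t, p.2.1.Realize (Sum.elim E' p.2.2) := by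
      intro p hp
      rcases ht hp with ⟨h1, h2⟩ | ⟨ν, hν', θ, h1, h2⟩
      · exact (hE' _ _ _ h1).2 h2
      · rw [h1, Formula.realize_relabel, Sum.elim_comp_map]
        exact hν ν hν' _ θ _ (fun i => Or.inr ⟨⟨⟨p, hp⟩, i⟩, rfl⟩) h2
    let g : (p : t) → Γ ⊕ Fin p.1.1 → Set.range E' ⊕ δ := fun p =>
      Sum.map (Set.rangeFactorization E') (fun i => ⟨p, i⟩)
    have hg : ∀ (p : t) (m : Set.range E' → 𝕄), Sum.elim m B ∘ g p
        = Sum.elim (m ∘ Set.rangeFactorization E') p.1.2.2 := by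
      intro p m
      ext x
      rcases x with x | x <;> simp [g, B]
    obtain ⟨χ, hχ⟩ := exists_conj (Finset.univ.image fun p : t => p.1.2.1.relabel (g p))
    obtain ⟨m, hm, hmχ⟩ := (hR _ _ _ hMs hrel).exists_realize χ B (fun i => Or.inr ⟨i, rfl⟩) (by
      rw [hχ]
      simp only [Finset.forall_mem_image, Formula.realize_relabel, hg]
      intro p _
      exact hE'p p p.2)
    rw [hχ] at hmχ
    simp only [Finset.forall_mem_image, Formula.realize_relabel, hg] at hmχ
    exact ⟨m ∘ Set.rangeFactorization E', fun i => hm _,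
      fun p hp => hmχ (x := ⟨p, hp⟩) (Finset.mem_univ _)⟩) (by
    rintro ⟨t, ht⟩ ⟨t', ht'⟩
    refine ⟨⟨t ∪ t', ?_⟩, ?_⟩
    · intro p hp
      rcases Finset.mem_union.1 hp with hp | hp
      · exact ht hp
      · exact ht' hp
    · rintro m ⟨h1, h2⟩
      exact ⟨⟨h1, fun p hp => h2 p (Finset.mem_union_left _ hp)⟩,
        ⟨h1, fun p hp => h2 p (Finset.mem_union_right _ hp)⟩⟩)
  have hVT : ∀ p ∈ T, ∀ᶠ m in (V : Filter (Γ → 𝕄)), p.2.1.Realize (Sum.elim m p.2.2) := by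
    intro p hp
    filter_upwards [hV ⟨{p}, by simpa using hp⟩] with m hm
    exact hm.2 p (by simp)
  refine ⟨V, ?_, ?_, ?_⟩
  · have : ∀ᶠ m in (V : Filter (Γ → 𝕄)), ∀ i, m i ∈ Ms := by
      filter_upwards [hV hne.some] with m hm using hm.1
    exact this
  · intro n χ c hc hχ
    by_contra h1
    have h2 := hVT ⟨n, χ.not, c⟩ (Or.inl ⟨hc, h1⟩)
    obtain ⟨m, hm, hm'⟩ := (hχ.and h2).exists
    exact hm' hm
  · intro ν hν C X hX n χ c hc hχ
    have h1 := hX n (χ.relabel (Sum.map ν id)) c hc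
      (hVT ⟨n, χ.relabel (Sum.map ν id), c⟩ (Or.inr ⟨ν, hν, χ, rfl, hχ⟩))
    rwa [Formula.realize_relabel, Sum.elim_comp_map] at h1

/-- `A` picks out of `E` a tree of depth `d` of blocks of length `N`, such that paths consist of
terms of a Morley sequence in `P`, and the first term of a block to the right realizes the average
type of `U` over blocks to the left. -/
def IsMorleyTree (L : FirstOrder.Language.{u, u}) {𝕄 : Type u} [L.Structure 𝕄] (Ms : Set 𝕄)
    {β Γ : Type u} (P U : Ultrafilter (β → 𝕄)) (N d : ℕ) (E : Γ → 𝕄)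
    (A : List Bool → ℕ → β → Γ) : Prop :=
  (∀ σ : List Bool, σ.length = d → ∃ π : ℕ → β → Γ,
    MS L (fun _ => P) Ms (d * N) (fun k => E ∘ π k) ∧
      ∀ l < d, ∀ j < N, ∃ k < d * N, π k = A (σ.take l) j) ∧
  (∀ η : List Bool, η.length < d → MS L (fun _ => P) Ms N (fun j => E ∘ A η j)) ∧
  ∀ μ η η' : List Bool, (μ ++ false :: η).length < d → (μ ++ true :: η').length < d →
    URealizes L U (E ∘ A (μ ++ true :: η') 0)
      (Ms ∪ ⋃ (j : ℕ) (_ : j < N), Set.range (E ∘ A (μ ++ false :: η) j))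

theorem IsMorleyTree.aut {Γ : Type u} {P U : Ultrafilter (β → 𝕄)} (hP : USupp P Ms)
    (hU : USupp U Ms) {N d : ℕ} {E : Γ → 𝕄} {A : List Bool → ℕ → β → Γ}
    (h : IsMorleyTree L Ms P U N d E A) (τ : 𝕄 ≃[L] 𝕄) (hτ : ∀ x ∈ Ms, τ x = x) :
    IsMorleyTree L Ms P U N d (τ ∘ E) A := by
  obtain ⟨h1, h2, h3⟩ := h
  refine ⟨fun σ hσ => ?_, fun η hη => (h2 η hη).aut' (fun _ _ => hP) τ hτ, ?_⟩
  · obtain ⟨π, hπ, hπA⟩ := h1 σ hσ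
    exact ⟨π, hπ.aut' (fun _ _ => hP) τ hτ, hπA⟩
  · intro μ η η' hη hη'
    have := (h3 μ η η' hη hη').aut hU τ hτ
    rw [Set.image_union, image_eq_of_fix hτ] at this
    refine this.mono (Set.union_subset_union_right _ ?_)
    refine Set.iUnion₂_subset fun j hj => ?_
    rintro _ ⟨x, rfl⟩
    exact ⟨_, Set.mem_iUnion₂.2 ⟨j, hj, x, rfl⟩, rfl⟩

theorem exists_isMorleyTree_succ [Nonempty 𝕄] (hM : IsMonster L 𝕄 κ) {R : IndRel L 𝕄}
    (hR : R.StrongerThanH) (hRC : R.CoheirChain κ)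
    (hMs : IsElemSubmodel L Ms) (hMssmall : Cardinal.mk Ms < κ) (hβ : Cardinal.mk β < κ)
    {P U : Ultrafilter (β → 𝕄)} (hP : USupp P Ms) (hU : USupp U Ms) {b : β → 𝕄}
    (hbP : URealizes L P b Ms) (hbU : URealizes L U b Ms) {N d : ℕ} (hN : 0 < N)
    {Γ : Type u} (hΓ : Cardinal.mk Γ < κ) {E : Γ → 𝕄} {𝒩 : Set (β → Γ)}
    {A : List Bool → ℕ → β → Γ} (hE : CanonicalExt R κ Ms U 𝒩 E) (hA : ∀ η j, A η j ∈ 𝒩)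
    (hT : IsMorleyTree L Ms P U N d E A) :
    ∃ (Γ' : Type u) (E' : Γ' → 𝕄) (𝒩' : Set (β → Γ')) (A' : List Bool → ℕ → β → Γ'),
      Cardinal.mk Γ' < κ ∧ CanonicalExt R κ Ms U 𝒩' E' ∧ (∀ η j, A' η j ∈ 𝒩') ∧
      IsMorleyTree L Ms P U N (d + 1) E' A' := by
  obtain ⟨V, hV, hEV, hVU⟩ := hE.exists_ultrafilter hM hR hMs
  obtain ⟨Q, hQ0, hQ⟩ := hM.exists_MS hΓ (fun _ => V) hMssmall 1 (fun _ => E) (by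
    intro i hi
    obtain rfl : i = 0 := by omega
    simpa using hEV)
  replace hQ0 : Q 0 = E := hQ0 0 one_pos
  have hQV : ∀ i, URealizes L V (Q i) (Ms ∪ ⋃ (j : ℕ) (_ : j < i), Set.range (Q j)) :=
    fun i => hQ (i + 1) i i.lt_succ_self
  have hE1 := hE.flatSeq hM hRC hMs hMssmall hΓ hV hQ hQ0
  let ν0 : β → ℕ × Γ := fun x => (0, A [] 0 x)
  let f : β ⊕ (ℕ × Γ) → ℕ × Γ := Sum.elim ν0 id
  have hf : Function.Surjective f := fun x => ⟨Sum.inr x, rfl⟩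
  have hE2 := hE1.comp hf
  have hΓ1 : Cardinal.mk (ℕ × Γ) < κ := mk_nat_prod_lt hM.1 hΓ
  have hΓ2 : Cardinal.mk (β ⊕ (ℕ × Γ)) < κ := mk_sum_lt hM.1 hβ hΓ1
  have hν0 : URealizes L P (flatSeq Q ∘ ν0) Ms :=
    hbP.of_eqTpOver (hbU.eqTpOver (hE1.uRealizes hM ⟨0, A [] 0, hA _ _, rfl⟩))
  obtain ⟨W, hW, hWP, hWE⟩ := exists_extend_ultrafilter hMs hP hν0 (flatSeq Q)
  have hfE : flatSeq Q ∘ f = Sum.elim (flatSeq Q ∘ ν0) (flatSeq Q) := by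
    ext x
    rcases x with x | x <;> rfl
  rw [← hfE] at hWE
  obtain ⟨Q2, hQ20, hQ2⟩ := hM.exists_MS hΓ2 (fun _ => W) hMssmall 1
    (fun _ => flatSeq Q ∘ f) (by
      intro i hi
      obtain rfl : i = 0 := by omega
      simpa using hWE)
  replace hQ20 : Q2 0 = flatSeq Q ∘ f := hQ20 0 one_pos
  have hE3 := hE2.flatSeq hM hRC hMs hMssmall hΓ2 hW hQ2 hQ20
  have hQ2P : ∀ n, MS L (fun _ => P) Ms n (fun i => Q2 i ∘ Sum.inl) := by
    intro n
    have := (hQ2 n).map_comp (Sum.inl : β → β ⊕ (ℕ × Γ))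
    simpa only [hWP] using this
  let A' : List Bool → ℕ → β → ℕ × (β ⊕ (ℕ × Γ)) := fun η j x =>
    match η with
    | [] => (j + 1, Sum.inl x)
    | i :: ν => (0, Sum.inr (i.toNat, A ν j x))
  have hA'nil : ∀ j, flatSeq Q2 ∘ A' [] j = Q2 (j + 1) ∘ Sum.inl := fun j => rfl
  have hA'cons : ∀ i ν j, flatSeq Q2 ∘ A' (i :: ν) j = Q i.toNat ∘ A ν j := by
    intro i ν j
    ext x
    change Q2 0 (Sum.inr (i.toNat, A ν j x)) = _
    rw [hQ20]
    rfl
  have hQi : ∀ i, IsMorleyTree L Ms P U N d (Q i) A := by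
    intro i
    obtain ⟨τ, hτ, hτE⟩ := hM.exists_aut hMssmall hΓ E (Q i)
      (hEV.eqTpOver ((hQV i).mono Set.subset_union_left))
    rw [← hτE]
    exact hT.aut hP hU τ hτ
  refine ⟨_, flatSeq Q2, _, A', mk_nat_prod_lt hM.1 hΓ2, hE3, ?_, ?_, ?_, ?_⟩
  · intro η j
    rcases η with _ | ⟨i, ν⟩
    · exact ⟨j + 1, Sum.inl, ⟨0, A [] 0, hA _ _, rfl⟩, rfl⟩
    · exact ⟨0, fun x => Sum.inr (i.toNat, A ν j x), ⟨i.toNat, A ν j, hA _ _, rfl⟩, rfl⟩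
  · intro σ hσ
    rcases σ with _ | ⟨i, σ⟩
    · simp at hσ
    obtain ⟨π, hπ, hπA⟩ := (hQi i.toNat).1 σ (by simpa using hσ)
    let π' : ℕ → β → ℕ × (β ⊕ (ℕ × Γ)) := fun k x =>
      if k < d * N then (0, Sum.inr (i.toNat, π k x)) else (k - d * N + 1, Sum.inl x)
    have hlt : ∀ k, k < d * N → flatSeq Q2 ∘ π' k = Q i.toNat ∘ π k := by
      intro k hk
      ext x
      simp only [π', hk, if_true, Function.comp, flatSeq, hQ20, f, Sum.elim_inr, id]
    have hge : ∀ k, ¬ k < d * N → flatSeq Q2 ∘ π' k = Q2 (k - d * N + 1) ∘ Sum.inl := by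
      intro k hk
      ext x
      simp only [π', hk, if_false, Function.comp, flatSeq]
    refine ⟨π', ?_, ?_⟩
    · intro k hk
      dsimp only
      by_cases h : k < d * N
      · rw [hlt k h]
        refine (hπ k h).mono (Set.union_subset_union_right _ ?_)
        refine Set.iUnion₂_mono fun j hj => ?_
        rw [hlt j (hj.trans h)]
      · rw [hge k h]
        have h2 := (hQ2 (k - d * N + 2) (k - d * N + 1) (by omega)).map_comp
          (Sum.inl : β → β ⊕ (ℕ × Γ))
        rw [hWP] at h2
        refine h2.mono (Set.union_subset_union_right _ ?_)
        refine Set.iUnion₂_subset fun j hj => ?_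
        by_cases h' : j < d * N
        · refine subset_trans ?_ (Set.subset_iUnion₂ (s := fun (j : ℕ) (_ : j < k - d * N + 1) =>
            Set.range (Q2 j)) 0 (by omega))
          rintro _ ⟨x, rfl⟩
          exact ⟨Sum.inr (i.toNat, π j x), by simp [π', h', flatSeq]⟩
        · refine subset_trans ?_ (Set.subset_iUnion₂ (s := fun (j : ℕ) (_ : j < k - d * N + 1) =>
            Set.range (Q2 j)) (j - d * N + 1) (by omega))
          rw [hge j h']
          rintro _ ⟨x, rfl⟩
          exact ⟨Sum.inl x, rfl⟩
    · intro l hl j hj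
      have hdN : (d + 1) * N = d * N + N := by ring
      rcases l with _ | l
      · refine ⟨d * N + j, by omega, ?_⟩
        ext x : 1
        simp [π', A']
      · obtain ⟨k, hk, hkA⟩ := hπA l (by omega) j hj
        refine ⟨k, by omega, ?_⟩
        ext x : 1
        simp [π', A', hk, hkA]
  · intro η hη
    rcases η with _ | ⟨i, ν⟩
    · simp only [hA'nil]
      exact (hQ2P (N + 1)).subseq (fun j => j + 1) (fun j hj => by omega) (fun i _ j hj => by omega)
    · simp only [hA'cons]
      exact (hQi i.toNat).2.1 ν (by simpa using hη)
  · intro μ η η' hη hη'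
    rcases μ with _ | ⟨i, μ⟩
    · simp only [List.nil_append, hA'cons]
      refine (hVU _ (hA _ _) _ _ (hQV 1)).mono (Set.union_subset_union_right _ ?_)
      refine Set.iUnion₂_subset fun j hj => ?_
      refine (Set.range_comp_subset_range _ _).trans ?_
      exact Set.subset_iUnion₂ (s := fun (j : ℕ) (_ : j < 1) => Set.range (Q j)) 0 one_pos
    · simp only [List.cons_append, hA'cons]
      exact (hQi i.toNat).2.2 μ η η' (by simpa using hη) (by simpa using hη')

theorem exists_isMorleyTree [Nonempty 𝕄] (hM : IsMonster L 𝕄 κ) {R : IndRel L 𝕄}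
    (hR : R.StrongerThanH) (hRC : R.CoheirChain κ)
    (hMs : IsElemSubmodel L Ms) (hMssmall : Cardinal.mk Ms < κ) (hβ : Cardinal.mk β < κ)
    {P U : Ultrafilter (β → 𝕄)} (hP : USupp P Ms) (hU : USupp U Ms) {b : β → 𝕄}
    (hcan : ∀ (δ : Type u), Cardinal.mk δ < κ → ∀ (B : δ → 𝕄) (c : β → 𝕄),
      URealizes L U c (Ms ∪ Set.range B) → R.rel (Set.range B) Ms (Set.range c))
    (hbP : URealizes L P b Ms) (hbU : URealizes L U b Ms) {N : ℕ} (hN : 0 < N) (d : ℕ) :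
    ∃ (Γ : Type u) (E : Γ → 𝕄) (𝒩 : Set (β → Γ)) (A : List Bool → ℕ → β → Γ),
      Cardinal.mk Γ < κ ∧ CanonicalExt R κ Ms U 𝒩 E ∧ (∀ η j, A η j ∈ 𝒩) ∧
      IsMorleyTree L Ms P U N d E A := by
  induction d with
  | zero =>
    refine ⟨β, b, {id}, fun _ _ => id, hβ,
      CanonicalExt.of_canonical hM hMssmall hβ hcan hbU, fun _ _ => rfl, ?_, ?_, ?_⟩
    · exact fun σ _ => ⟨fun _ => id, fun i hi => by simp at hi, fun l hl => by simp at hl⟩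
    · exact fun η hη => by simp at hη
    · exact fun μ η η' hη => by simp at hη
  | succ d ih =>
    obtain ⟨Γ, E, 𝒩, A, hΓ, hE, hA, hT⟩ := ih
    exact exists_isMorleyTree_succ hM hR hRC hMs hMssmall hβ hP hU hbP hbU hN hΓ hE hA hT

end CanonicalTrees

section KimLemma

variable {L : FirstOrder.Language.{u, u}} {𝕄 : Type u} [L.Structure 𝕄] {κ : Cardinal.{u}}
  {Ms : Set 𝕄}

/-- Concatenation of two Morley sequences. -/
theorem MS.append {β : Type v} {U U' : ℕ → Ultrafilter (β → 𝕄)} {C D : Set 𝕄} {k m : ℕ}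
    {P Z : ℕ → β → 𝕄} (h : MS L U C k P) (h' : MS L U' D m Z) (hCD : C ⊆ D)
    (hP : ∀ j < k, Set.range (P j) ⊆ D) :
    MS L (fun i => if i < k then U i else U' (i - k)) C (k + m)
      (fun i => if i < k then P i else Z (i - k)) := by
  intro i hi
  by_cases hik : i < k
  · simp only [hik, if_true]
    refine (h i hik).mono (Set.union_subset_union_right _ (Set.iUnion₂_mono fun j hj => ?_))
    rw [if_pos (hj.trans hik)]
  · simp only [hik, if_false]
    refine (h' (i - k) (by omega)).mono (Set.union_subset (hCD.trans Set.subset_union_left) ?_)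
    refine Set.iUnion₂_subset fun j hj => ?_
    by_cases hjk : j < k
    · rw [if_pos hjk]
      exact (hP j hjk).trans Set.subset_union_left
    · rw [if_neg hjk]
      have hjk' : j - k < i - k := by omega
      exact fun x hx => Or.inr (Set.mem_iUnion₂.2 ⟨j - k, hjk', hx⟩)

/-- Consistency of the instances of a formula along a Morley sequence depends only on the
ultrafilters in which the sequence is Morley. -/
theorem MS.consistent_of_consistent [Nonempty 𝕄] (hM : IsMonster L 𝕄 κ)
    (hMs : IsElemSubmodel L Ms) (hMssmall : Cardinal.mk Ms < κ) {α : Type v} {β : Type u}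
    (hβ : Cardinal.mk β < κ) {N : ℕ} {U : ℕ → Ultrafilter (β → 𝕄)}
    (hU : ∀ i < N, USupp (U i) Ms) {Q Q' : ℕ → β → 𝕄} (h : MS L U Ms N Q) (h' : MS L U Ms N Q')
    {n : ℕ} (φ : L.Formula (α ⊕ Fin n)) (e : Fin n → β ⊕ Ms)
    (hcon : ∃ a, ∀ i < N, φ.Realize (Sum.elim a (dpart e (Q i)))) :
    ∃ a, ∀ i < N, φ.Realize (Sum.elim a (dpart e (Q' i))) := by
  obtain ⟨a, ha⟩ := hcon
  have hs : Cardinal.mk (Fin N × β) < κ := by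
    refine (Cardinal.mk_le_of_injective (f := fun p : Fin N × β => ((p.1 : ℕ), p.2)) ?_).trans_lt
      (mk_nat_prod_lt hM.1 hβ)
    rintro ⟨i, x⟩ ⟨j, y⟩ hij
    simpa [Fin.ext_iff] using hij
  obtain ⟨σ, hσ, hσQ⟩ := hM.exists_aut hMssmall hs _ _
    (MS.eqTpOver hMs.nonempty hU subset_rfl h h')
  refine ⟨σ ∘ a, fun i hi => ?_⟩
  have e1 : Q' i = σ ∘ Q i := by
    ext x
    exact (congrFun hσQ (⟨i, hi⟩, x)).symm
  rw [e1, dpart_aut e _ σ hσ]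
  exact (realize_aut σ φ a _).2 (ha i hi)

/-- `φ` is consistent along sequences over `Ms` which are Morley in `P` for `N` steps and then
Morley in `U` for `m` steps. -/
def ConsistentAlong (Ms : Set 𝕄) {α : Type v} {β : Type u} {n : ℕ} (φ : L.Formula (α ⊕ Fin n))
    (e : Fin n → β ⊕ Ms) (P U : Ultrafilter (β → 𝕄)) (N m : ℕ) : Prop :=
  ∃ Q : ℕ → β → 𝕄, MS L (fun i => if i < N then P else U) Ms (N + m) Q ∧
    ∃ a : α → 𝕄, ∀ i < N + m, φ.Realize (Sum.elim a (dpart e (Q i)))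

theorem ConsistentAlong.of_succ {α : Type v} {β : Type u} {n : ℕ} {φ : L.Formula (α ⊕ Fin n)}
    {e : Fin n → β ⊕ Ms} {P U : Ultrafilter (β → 𝕄)} {N m : ℕ}
    (h : ConsistentAlong Ms φ e P U (N + 1) m) : ConsistentAlong Ms φ e P U N m := by
  obtain ⟨Q, hQ, a, ha⟩ := h
  refine ⟨fun i => Q (i + 1), ?_, a, fun i hi => ha (i + 1) (by omega)⟩
  simpa using hQ.subseq (m := N + m) (fun i => i + 1) (fun i hi => by omega)
    (fun i _ j hj => by omega)

theorem hasSOP2_of_not_consistentAlong [Nonempty 𝕄] (hM : IsMonster L 𝕄 κ) {R : IndRel L 𝕄}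
    (hR : R.StrongerThanH) (hRC : R.CoheirChain κ) (hMs : IsElemSubmodel L Ms)
    (hMssmall : Cardinal.mk Ms < κ) {α : Type v} {β : Type u} (hβ : Cardinal.mk β < κ)
    {P U : Ultrafilter (β → 𝕄)} (hP : USupp P Ms) (hU : USupp U Ms)
    (hcan : ∀ (δ : Type u), Cardinal.mk δ < κ → ∀ (B : δ → 𝕄) (c : β → 𝕄),
      URealizes L U c (Ms ∪ Set.range B) → R.rel (Set.range B) Ms (Set.range c))
    {b : β → 𝕄} (hbP : URealizes L P b Ms) (hbU : URealizes L U b Ms) {n : ℕ}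
    (φ : L.Formula (α ⊕ Fin n)) (e : Fin n → β ⊕ Ms) {N m : ℕ} (hN : 0 < N)
    (hcon : ∀ N', ConsistentAlong Ms φ e P U N' m)
    (hincon : ¬ ConsistentAlong Ms φ e P U N (m + 1)) : HasSOP2 L 𝕄 := by
  classical
  obtain ⟨ψ, hψ⟩ := exists_conj (A := α ⊕ ((Fin N ⊕ Fin m) × Fin n))
    (Finset.univ.image fun k : Fin N ⊕ Fin m =>
      φ.relabel (Sum.map id fun i => (k, i) : α ⊕ Fin n → α ⊕ ((Fin N ⊕ Fin m) × Fin n)))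
  have hψ' : ∀ (a : α → 𝕄) (w : (Fin N ⊕ Fin m) × Fin n → 𝕄), ψ.Realize (Sum.elim a w) ↔
      ∀ k, φ.Realize (Sum.elim a fun i => w (k, i)) := by
    intro a w
    rw [hψ]
    simp only [Finset.forall_mem_image, Formula.realize_relabel, Sum.elim_comp_map,
      Function.comp_id, Finset.mem_univ, true_imp_iff]
    rfl
  refine hasSOP2_of_finite_trees hM ψ fun d => ?_
  obtain ⟨Γ, E, 𝒩, A, hΓ, -, -, hpath, hblock, hincomp⟩ :=
    exists_isMorleyTree hM hR hRC hMs hMssmall hβ hP hU hcan hbP hbU hN d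
  obtain ⟨Z, -, hZ⟩ := hM.exists_MS hβ (fun _ => U)
    (mk_union_lt hM.1 hMssmall (mk_range_lt hΓ E)) 0 (fun _ => b)
    (fun i hi => (Nat.not_lt_zero i hi).elim)
  have hE : ∀ ν : β → Γ, Set.range (E ∘ ν) ⊆ Ms ∪ Set.range E := fun ν =>
    (Set.range_comp_subset_range ν E).trans Set.subset_union_right
  refine ⟨fun η y => Sum.elim (fun j : Fin N => dpart e (E ∘ A η j) y.2)
    (fun k : Fin m => dpart e (Z k) y.2) y.1, fun σ hσ => ?_, fun μ η η' hη hη' => ?_⟩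
  · obtain ⟨π, hπ, hπA⟩ := hpath σ hσ
    have hS := hπ.append (hZ m) Set.subset_union_left fun j _ => hE _
    obtain ⟨Q, hQ, ha⟩ := hcon (d * N)
    obtain ⟨a, ha⟩ := MS.consistent_of_consistent hM hMs hMssmall hβ
      (by intro i _; split_ifs <;> assumption) hQ hS φ e ha
    refine ⟨a, fun l hl => (hψ' _ _).2 ?_⟩
    rintro (j | k)
    · obtain ⟨k, hk, hkA⟩ := hπA l hl j j.2
      have := ha k (by omega)
      rw [if_pos hk, hkA] at this
      exact this
    · have := ha (d * N + k) (by omega)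
      rw [if_neg (by omega), Nat.add_sub_cancel_left] at this
      exact this
  · rintro ⟨a, ha, ha'⟩
    rw [hψ'] at ha ha'
    refine hincon ?_
    have h1 : MS L (fun _ => U) (Ms ∪ ⋃ (j : ℕ) (_ : j < N),
        Set.range (E ∘ A (μ ++ false :: η) j)) 1 (fun _ => E ∘ A (μ ++ true :: η') 0) := by
      intro i hi
      obtain rfl : i = 0 := by omega
      simpa using hincomp μ η η' hη hη'
    have h2 := h1.append (hZ m) (Set.union_subset Set.subset_union_left
      (Set.iUnion₂_subset fun j _ => hE _)) fun j _ => hE _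
    have h3 := (hblock _ hη).append h2 Set.subset_union_left fun j hj x hx =>
      Or.inr (Set.mem_iUnion₂.2 ⟨j, hj, hx⟩)
    simp only [ite_self] at h3
    refine ⟨_, add_comm 1 m ▸ h3, a, fun i hi => ?_⟩
    split_ifs with h4 h5
    · exact ha (Sum.inl ⟨i, h4⟩)
    · exact ha' (Sum.inl ⟨0, hN⟩)
    · exact ha (Sum.inr ⟨i - N - 1, by omega⟩)

theorem exists_coheir_consistentAlong [Nonempty 𝕄] (hM : IsMonster L 𝕄 κ)
    (hMs : IsElemSubmodel L Ms) (hMssmall : Cardinal.mk Ms < κ) {α : Type v} {β : Type u}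
    (hβ : Cardinal.mk β < κ) (b : β → 𝕄) {n : ℕ} (φ : L.Formula (α ⊕ Fin n))
    (e : Fin n → β ⊕ Ms) {B : ℕ → Fin n → 𝕄} (hB : CoheirMorley L Ms B) (hB0 : B 0 = dpart e b)
    (hcon : ∃ a : α → 𝕄, ∀ i, φ.Realize (Sum.elim a (B i))) (U : Ultrafilter (β → 𝕄)) :
    ∃ P : Ultrafilter (β → 𝕄), USupp P Ms ∧ URealizes L P b Ms ∧
      ∀ N, ConsistentAlong Ms φ e P U N 0 := by
  obtain ⟨U0, hU0, hBU⟩ := coheirMorley_iff.1 hB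
  have hb : URealizes L U0 (dpart e b) Ms := by
    rw [← hB0]
    exact (hBU 1 0 one_pos).mono Set.subset_union_left
  obtain ⟨V, hV, hV0, hVb⟩ := exists_extend_ultrafilter hMs hU0 hb b
  refine ⟨V.map fun m => m ∘ Sum.inr, hV.map_comp Sum.inr, hVb.map_comp Sum.inr, fun N => ?_⟩
  have hs : Cardinal.mk (Fin n ⊕ β) < κ := by
    rw [Cardinal.mk_sum, Cardinal.mk_fin, Cardinal.lift_natCast, Cardinal.lift_uzero]
    exact Cardinal.add_lt_of_lt hM.1.le ((Cardinal.natCast_lt_aleph0).trans hM.1) hβ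
  obtain ⟨Q, -, hQ⟩ := hM.exists_MS hs (fun _ => V) hMssmall 0 (fun _ => Sum.elim (dpart e b) b)
    (fun i hi => (Nat.not_lt_zero i hi).elim)
  have hQe : ∀ i, dpart e (Q i ∘ Sum.inr) = Q i ∘ Sum.inl := by
    intro i
    have h1 := hVb.eqTpOver ((hQ (i + 1) i i.lt_succ_self).mono Set.subset_union_left)
    ext x
    let θ : L.Formula ((Fin n ⊕ β) ⊕ Ms) := Term.equal (Term.var (Sum.inl (Sum.inl x)))
      (Term.var (Sum.elim (fun y => Sum.inl (Sum.inr y)) Sum.inr (e x)))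
    have h2 := h1.realize_iff θ (Subtype.val : Ms → 𝕄) fun i => i.2
    cases hx : e x <;> simpa [θ, Formula.realize_equal, dpart, hx, eq_comm] using h2
  obtain ⟨a, ha⟩ := hcon
  have hQl : MS L (fun _ => U0) Ms N fun i => Q i ∘ Sum.inl := by
    rw [← hV0]
    exact (hQ N).map_comp Sum.inl
  obtain ⟨a', ha'⟩ := MS.consistent_of_consistent hM hMs hMssmall (β := ULift.{u} (Fin n))
    (by simpa using Cardinal.natCast_lt_aleph0.trans hM.1) (fun _ _ => hU0.map_comp ULift.down)
    ((hBU N).map_comp ULift.down) (hQl.map_comp ULift.down) φ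
    (fun i => Sum.inl (ULift.up i)) ⟨a, fun i _ => ha i⟩
  refine ⟨fun i => Q i ∘ Sum.inr, ?_, a', fun i hi => ?_⟩
  · intro i hi
    have := (hQ N).map_comp Sum.inr i hi
    simpa [show i < N from hi] using this
  · rw [hQe]
    exact ha' i hi

/-- A Kim's lemma for canonical Morley sequences: a formula consistent along some coheir Morley
sequence is consistent along every canonical Morley sequence. -/
theorem IsMonster.consistent_of_canonical [Nonempty 𝕄] (hM : IsMonster L 𝕄 κ)
    (hT : ¬ HasSOP2 L 𝕄) {R : IndRel L 𝕄} (hR : R.StrongerThanH) (hRC : R.CoheirChain κ)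
    (hMs : IsElemSubmodel L Ms) (hMssmall : Cardinal.mk Ms < κ) {α β : Type u}
    (hα : Cardinal.mk α < κ) (hβ : Cardinal.mk β < κ) {U : Ultrafilter (β → 𝕄)} (hU : USupp U Ms)
    (hcan : ∀ (δ : Type u), Cardinal.mk δ < κ → ∀ (B : δ → 𝕄) (c : β → 𝕄),
      URealizes L U c (Ms ∪ Set.range B) → R.rel (Set.range B) Ms (Set.range c))
    {b : β → 𝕄} {I : ℕ → β → 𝕄} (hI : ∀ n, MS L (fun _ => U) Ms n I) (hI0 : I 0 = b) {n : ℕ}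
    (φ : L.Formula (α ⊕ Fin n)) (e : Fin n → β ⊕ Ms) {B : ℕ → Fin n → 𝕄}
    (hB : CoheirMorley L Ms B) (hB0 : B 0 = dpart e b)
    (hcon : ∃ a : α → 𝕄, ∀ i, φ.Realize (Sum.elim a (B i))) :
    ∃ a : α → 𝕄, ∀ i, φ.Realize (Sum.elim a (dpart e (I i))) := by
  obtain ⟨P, hP, hPb, h0⟩ := exists_coheir_consistentAlong hM hMs hMssmall hβ b φ e hB hB0 hcon U
  have hUb : URealizes L U b Ms := by
    rw [← hI0]
    exact (hI 1 0 one_pos).mono Set.subset_union_left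
  have hall : ∀ m N, ConsistentAlong Ms φ e P U N m := by
    intro m
    induction m with
    | zero => exact h0
    | succ m ih =>
      intro N
      by_contra h
      exact hT (hasSOP2_of_not_consistentAlong hM hR hRC hMs hMssmall hβ hP hU hcan hPb hUb φ e
        N.succ_pos ih fun h' => h h'.of_succ)
  have hfin : ∀ m, ∃ a : α → 𝕄, ∀ i < m, φ.Realize (Sum.elim a (dpart e (I i))) := by
    intro m
    obtain ⟨Q, hQ, ha⟩ := hall m 0
    simp only [Nat.not_lt_zero, if_false, Nat.zero_add] at hQ ha
    exact MS.consistent_of_consistent hM hMs hMssmall hβ (fun _ _ => hU) hQ (hI m) φ e ha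
  let g : ℕ → α ⊕ Fin n → α ⊕ (ℕ × ULift.{u} (Fin n)) := fun i =>
    Sum.map id fun j => (i, ULift.up j)
  have hg : ∀ i (a : α → 𝕄), Sum.elim a
      (fun p : ℕ × ULift.{u} (Fin n) => dpart e (I p.1) p.2.down) ∘ g i
      = Sum.elim a (dpart e (I i)) := by
    intro i a
    ext x
    rcases x with x | x <;> simp [g]
  obtain ⟨a, ha⟩ := hM.exists_realize hα
    (mk_nat_prod_lt hM.1 (β := ULift.{u} (Fin n)) (by simpa using Cardinal.natCast_lt_aleph0.trans hM.1))
    (fun p => dpart e (I p.1) p.2.down) {χ | ∃ i, χ = φ.relabel (g i)} (by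
      intro t ht
      choose i hi using fun χ : t => ht χ.2
      obtain ⟨a, ha⟩ := hfin (Finset.univ.sup i + 1)
      refine ⟨a, fun χ hχ => ?_⟩
      have h1 := hi ⟨χ, hχ⟩
      dsimp only at h1
      rw [h1, Formula.realize_relabel, hg]
      exact ha _ (Nat.lt_succ_of_le (Finset.le_sup (f := i) (Finset.mem_univ _))))
  refine ⟨a, fun i => ?_⟩
  have := ha _ ⟨i, rfl⟩
  rwa [Formula.realize_relabel, hg] at this

end KimLemma

theorem ConantDivides.conantForks {L : FirstOrder.Language.{u, u}} {𝕄 : Type u} [L.Structure 𝕄]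
    {Ms : Set 𝕄} {α : Type v} {n : ℕ} {φ : L.Formula (α ⊕ Fin n)} {b : Fin n → 𝕄}
    (h : ConantDivides L Ms φ b) : ConantForks L Ms φ b :=
  ⟨1, fun _ => n, fun _ => φ, fun _ => b, fun _ => h, fun _ ha => ⟨0, ha⟩⟩

/-- **Proposition 5.3 (canonical chain condition).** Let `T` be `NSOP₂` and
suppose `a ⫝^{K*}_M b`.  Then for any canonical Morley sequence `I` over `M`
starting with `b`, there is `I' ≡_{Mb} I` indiscernible over `Ma`; and any
such `I'` satisfies `a ⫝^{K*}_M I'`. -/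
theorem canonical_chain_condition (L : FirstOrder.Language.{u, u}) (𝕄 : Type u)
    [L.Structure 𝕄] (κ : Cardinal.{u}) (hmonster : IsMonster L 𝕄 κ)
    (hNSOP2 : ¬ HasSOP2 L 𝕄)
    (R : IndRel L 𝕄) (hCK : IsCK R κ)
    (Ms : Set 𝕄) (hMs : IsElemSubmodel L Ms) (hMssmall : Cardinal.mk Ms < κ)
    (α β : Type u) (hα : Cardinal.mk α < κ) (hβ : Cardinal.mk β < κ)
    (a : α → 𝕄) (b : β → 𝕄) (hab : ConantIndep L Ms a b)
    (I : ℕ → β → 𝕄) (hI : CanonicalMorley R κ Ms I) (hI0 : I 0 = b) :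
    (∃ I' : ℕ → β → 𝕄, EqTpOver L (Ms ∪ Set.range b) (flatSeq I') (flatSeq I) ∧
      IndiscernibleOver L (Ms ∪ Set.range a) I') ∧
    (∀ I' : ℕ → β → 𝕄, EqTpOver L (Ms ∪ Set.range b) (flatSeq I') (flatSeq I) →
      IndiscernibleOver L (Ms ∪ Set.range a) I' →
      ConantIndep L Ms a (flatSeq I')) := by
  rcases isEmpty_or_nonempty 𝕄 with h𝕄 | h𝕄
  · refine ⟨⟨I, EqTpOver.refl _ _, fun n f g _ _ => ?_⟩, fun I' _ _ n φ d _ hφ => ?_⟩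
    · rw [Subsingleton.elim (fun p : Fin n × β => I (f p.1) p.2) fun p => I (g p.1) p.2]
      exact EqTpOver.refl _ _
    · exact hab n φ d (fun i => isEmptyElim (d i)) hφ
  obtain ⟨q, hq, hqM, hqI⟩ := hI
  obtain ⟨U, hU, hqU⟩ := q.exists_ultrafilter hqM
  have hIU : ∀ n, MS L (fun _ => U) Ms n I := fun n i _ => (hqU _ _).1 (hqI i)
  refine ⟨exists_indiscernible_of_consistent hmonster hMs hMssmall hα hβ a b hU hIU hI0
    fun n φ e hφ => ?_, fun I' hI' hind => ?_⟩
  · by_contra hcon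
    refine hab n φ (dpart e b) (fun i => ?_) hφ
      (ConantDivides.conantForks fun B hB hB0 hcon' => hcon ?_)
    · cases hx : e i with
      | inl x => exact Or.inr ⟨x, by simp [dpart, hx]⟩
      | inr x => exact Or.inl (by simp [dpart, hx])
    · exact hmonster.consistent_of_canonical hNSOP2 hCK.1.1 hCK.1.2.2.2.2.2 hMs hMssmall hα hβ hU
        (fun δ hδ B c hc => hq δ hδ B c ((hqU _ _).2 hc)) hIU hI0 φ e hB hB0 hcon'
  · obtain ⟨σ, hσ, hσI⟩ := hmonster.exists_aut hMssmall (mk_nat_prod_lt hmonster.1 hβ) _ _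
      (hI'.mono Set.subset_union_left).symm
    have hI'σ : I' = fun i => σ ∘ I i := by
      ext i x
      exact (congrFun hσI (i, x)).symm
    refine conantIndep_of_indiscernible hmonster hMs hMssmall hβ a hU (fun n => ?_) hind
    rw [hI'σ]
    exact (hIU n).aut' (fun _ _ => hU) σ hσ

end NSOP2Paper
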